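/- Let q be a prime power of characteristic p, and let F_1,…,F_m ∈ F_q[t][x] with deg_x F_i = r_i > 0 be pairwise non-associate, irreducible, monic in x, and separable over F_q(t). Let n ≥ 3 satisfy n ≥ sl F_i for all i, let a_0,…,a_n be algebraically independent variables, f♯ = Σ_{j=0}^n a_j t^j, and N_i = r_i n. For each i let F_i = ∏_{j=1}^{μ_i} G_{ij} be the decomposition of F_i into absolutely irreducible factors G_{ij} ∈ F_{q^{μ_i}}[t][x], where F_{q^{μ_i}} is the minimal field over which F_i splits into absolutely irreducible factors, and let F_{q^μ} be the composite of the fields F_{q^{μ_i}}. Let L be the splitting field of ∏_i F_i(t, f♯) over F_q(a_0,…,a_n), G = Gal(L/F_q(a_0,…,a_n)), and let Ω_{ij} be the set of roots of G_{ij}(t, f♯) in L. The group H_μ = Gal(F_{q^μ}/F_q) ≅ Z/μ acts on the factors {G_{ij}}_j of each F_i (transitively, factoring through a principal action of Gal(F_{q^{μ_i}}/F_q) ≅ Z/μ_i); write Ω_{ij}^σ for the root set of G_{ij}^σ. Then G consists exactly of all permutations π of ⋃_{i,j} Ω_{ij} for which there exists σ ∈ H_μ with π(Ω_{ij}) = Ω_{ij}^σ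 for every i and j. -/

import Mathlib

open Polynomial

/-- The slope of `P(t,x) = Σ_{j=0}^r c_j(t) x^j ∈ K[t][x]` monic in `x` (with `x` the
outer variable): `sl P = max_{1 ≤ j ≤ r} deg c_{r-j}(t) / j`, where `deg 0 = ⊥`. -/
noncomputable def slopeX {K : Type} [Field K] (P : Polynomial (Polynomial K)) : WithBot ℚ :=
  (Finset.Icc 1 P.natDegree).sup fun j =>
    ((P.coeff (P.natDegree - j)).degree).map fun d : ℕ => (d : ℚ) / (j : ℚ)

/-- The generic polynomial `f♯ = Σ_{j=0}^n a_j t^j`. -/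
noncomputable def fsharp (K : Type) [CommRing K] (n : ℕ) :
    Polynomial (MvPolynomial (Fin (n + 1)) K) :=
  ∑ j : Fin (n + 1), Polynomial.C (MvPolynomial.X j) * Polynomial.X ^ (j : ℕ)

/-- For `F ∈ K[t][x]` (with `x` the outer variable), the substitution
`F(t, f♯) ∈ K[a_0,…,a_n][t]`. -/
noncomputable def substF {K : Type} [CommRing K] (n : ℕ)
    (F : Polynomial (Polynomial K)) :
    Polynomial (MvPolynomial (Fin (n + 1)) K) :=
  Polynomial.eval (fsharp K n) (F.map (Polynomial.mapRingHom MvPolynomial.C))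

/-- Raising all coefficients (of the coefficients) of `G ∈ L[t][x]` to the power
`q^e`; for `G` with coefficients in a finite subfield of `L` this is the action of
the `e`-th power of the `q`-Frobenius `σ ∈ Gal(F̄_q/F_q)` on `G`. -/
noncomputable def frobTwist {L : Type} [Field L] (q e : ℕ)
    (G : Polynomial (Polynomial L)) : Polynomial (Polynomial L) :=
  G.sum fun a c => Polynomial.monomial a (c.sum fun b z => Polynomial.monomial b (z ^ q ^ e))


section HenselPart

variable {W : Type} [Field W]

lemma ps_isUnit_iff (a : PowerSeries W) :
    IsUnit a ↔ PowerSeries.constantCoeff a ≠ 0 := by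
  rw [PowerSeries.isUnit_iff_constantCoeff, isUnit_iff_ne_zero]

lemma ps_hensel_root (P : Polynomial (PowerSeries W)) (hP : P.Monic) (r : W)
    (h0 : (P.map (PowerSeries.constantCoeff (R := W))).eval r = 0)
    (h1 : (derivative (P.map (PowerSeries.constantCoeff (R := W)))).eval r ≠ 0) :
    ∃ ρ : PowerSeries W, P.IsRoot ρ ∧ PowerSeries.constantCoeff ρ = r := by
  have key : ∀ Q : Polynomial (PowerSeries W), PowerSeries.constantCoeff (Q.eval (PowerSeries.C r))
      = (Q.map (PowerSeries.constantCoeff (R := W))).eval r := by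
    intro Q
    rw [eval_map, ← coe_eval₂RingHom, eval, hom_eval₂]
    simp
  have hmem : ∀ a : PowerSeries W, a ∈ Ideal.span {(PowerSeries.X : PowerSeries W)} ↔
      PowerSeries.constantCoeff a = 0 := by
    intro a
    rw [Ideal.mem_span_singleton, PowerSeries.X_dvd_iff]
  obtain ⟨ρ, hρ, hρ'⟩ := HenselianRing.is_henselian
    (I := Ideal.span {(PowerSeries.X : PowerSeries W)}) P hP (PowerSeries.C r)
    (by rw [hmem, key, h0])
    (by
      apply IsUnit.map
      rw [ps_isUnit_iff, key, ← derivative_map]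
      exact h1)
  refine ⟨ρ, hρ, ?_⟩
  rw [hmem] at hρ'
  simpa [sub_eq_zero] using hρ'

lemma ps_lc_unit (P : Polynomial (PowerSeries W)) (hne : P.map (PowerSeries.constantCoeff (R := W)) ≠ 0)
    (hdeg : (P.map (PowerSeries.constantCoeff (R := W))).natDegree = P.natDegree) :
    IsUnit P.leadingCoeff := by
  rw [ps_isUnit_iff, leadingCoeff, ← hdeg, ← coeff_map]
  simpa using hne

/-- normalise to a monic polynomial -/
lemma ps_monic (P : Polynomial (PowerSeries W)) (hne : P.map (PowerSeries.constantCoeff (R := W)) ≠ 0)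
    (hdeg : (P.map (PowerSeries.constantCoeff (R := W))).natDegree = P.natDegree) :
    ∃ (u : (PowerSeries W)ˣ) (Q : Polynomial (PowerSeries W)), Q.Monic ∧
      P = C (u : PowerSeries W) * Q := by
  obtain ⟨u, hu⟩ := ps_lc_unit P hne hdeg
  refine ⟨u, C (↑u⁻¹ : PowerSeries W) * P, ?_, ?_⟩
  · have := monic_C_mul_of_mul_leadingCoeff_eq_one (p := P) (b := (↑u⁻¹ : PowerSeries W))
      (by rw [← hu]; simp)
    exact this
  · rw [← mul_assoc, ← C_mul]; simp

lemma ps_irr_of_red (P : Polynomial (PowerSeries W))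
    (hirr : Irreducible (P.map (PowerSeries.constantCoeff (R := W))))
    (hdeg : (P.map (PowerSeries.constantCoeff (R := W))).natDegree = P.natDegree) :
    Irreducible (P.map (algebraMap (PowerSeries W) (FractionRing (PowerSeries W)))) := by
  obtain ⟨u, Q, hQ, rfl⟩ := ps_monic P hirr.ne_zero hdeg
  rw [Polynomial.map_mul, map_C] at hirr ⊢
  rw [irreducible_isUnit_mul] at hirr ⊢
  · exact (Monic.irreducible_iff_irreducible_map_fraction_map hQ).1
      (Monic.irreducible_of_irreducible_map _ Q hQ hirr)
  · exact isUnit_C.2 (u.isUnit.map _)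
  · exact isUnit_C.2 (u.isUnit.map _)

lemma ps_factor_root (P : Polynomial (PowerSeries W)) (r : W) (H : W[X])
    (hdeg : (P.map (PowerSeries.constantCoeff (R := W))).natDegree = P.natDegree)
    (hfac : P.map (PowerSeries.constantCoeff (R := W)) = (X - C r) * H)
    (hr : H.eval r ≠ 0) :
    ∃ (τ : PowerSeries W) (R : Polynomial (PowerSeries W)), P = (X - C τ) * R ∧
      R.map (PowerSeries.constantCoeff (R := W)) = H ∧ H.natDegree = R.natDegree := by
  have hH : H ≠ 0 := by rintro rfl; simp at hr
  have hne : P.map (PowerSeries.constantCoeff (R := W)) ≠ 0 := by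
    rw [hfac]; exact mul_ne_zero (X_sub_C_ne_zero r) hH
  obtain ⟨u, Q, hQ, rfl⟩ := ps_monic P hne hdeg
  rw [Polynomial.map_mul, map_C] at hfac
  have hu0 : PowerSeries.constantCoeff (u : PowerSeries W) ≠ 0 := (ps_isUnit_iff _).1 u.isUnit
  have e1 : (Q.map (PowerSeries.constantCoeff (R := W))).eval r = 0 := by
    have := congrArg (eval r) hfac
    simp at this
    exact this.resolve_left hu0
  have e2 : (derivative (Q.map (PowerSeries.constantCoeff (R := W)))).eval r ≠ 0 := by
    intro h
    have := congrArg (fun p => eval r (derivative p)) hfac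
    rw [derivative_map] at h
    simp [h] at this
    exact hr this.symm
  obtain ⟨τ, hτ, hτ'⟩ := ps_hensel_root Q hQ r e1 e2
  obtain ⟨R, hR⟩ := dvd_iff_isRoot.2 hτ
  have hR0 : (C (u : PowerSeries W) * R).map (PowerSeries.constantCoeff (R := W)) = H := by
    apply mul_left_cancel₀ (X_sub_C_ne_zero r)
    rw [← hfac, hR]
    simp [hτ']; ring
  have hfac2 : C (u : PowerSeries W) * Q = (X - C τ) * (C (u : PowerSeries W) * R) := by rw [hR]; ring
  refine ⟨τ, C (u : PowerSeries W) * R, hfac2, hR0, ?_⟩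
  have hne' : C (u : PowerSeries W) * R ≠ 0 := by
    intro h; rw [h] at hR0; simp at hR0; exact hH hR0.symm
  have := hdeg
  rw [hfac2, Polynomial.map_mul, hR0, natDegree_mul (X_sub_C_ne_zero _) hne',
    natDegree_mul (by simpa using X_sub_C_ne_zero _) hH] at this
  simpa using this

lemma ps_double_aux [IsAlgClosed W] (t0 : W) (d : ℕ) : ∀ (P : Polynomial (PowerSeries W)) (q : W[X]),
    q.natDegree = d →
    (P.map (PowerSeries.constantCoeff (R := W))).natDegree = P.natDegree →
    P.map (PowerSeries.constantCoeff (R := W)) = (X - C t0) ^ 2 * q →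
    q.Separable → q.eval t0 ≠ 0 →
    ∃ (g : Polynomial (PowerSeries W)) (u : W) (s : Multiset (PowerSeries W)), 
      P = g * (s.map fun ρ => X - C ρ).prod ∧ u ≠ 0 ∧
      g.map (PowerSeries.constantCoeff (R := W)) = C u * (X - C t0) ^ 2 ∧ g.natDegree = 2 := by
  induction d with
  | zero =>
    intro P q hq hdeg hfac hsep ht0
    obtain ⟨u, rfl⟩ := natDegree_eq_zero.1 hq
    have hu : u ≠ 0 := by simpa using ht0
    refine ⟨P, u, 0, by simp, hu, by rw [hfac]; ring, ?_⟩
    rw [← hdeg, hfac, mul_comm, natDegree_C_mul hu]; simp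
  | succ d ih =>
    intro P q hq hdeg hfac hsep ht0
    obtain ⟨r, hr⟩ := IsAlgClosed.exists_root q (by
      intro h; have := natDegree_eq_zero_iff_degree_le_zero.2 h.le; omega)
    obtain ⟨q', rfl⟩ := dvd_iff_isRoot.2 hr
    have hq'0 : q' ≠ 0 := by rintro rfl; simp at hq
    have hr' : q'.eval r ≠ 0 := by
      have := hsep.eval₂_derivative_ne_zero (RingHom.id W) (x := r) (by simp)
      simpa using this
    have hrt : r ≠ t0 := by rintro rfl; simp at ht0
    obtain ⟨τ, R, rfl, hR, hRd⟩ := ps_factor_root P r ((X - C t0) ^ 2 * q') hdeg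
      (by rw [hfac]; ring) (by simp [hr', sub_eq_zero, hrt])
    have hd' : q'.natDegree = d := by
      rw [natDegree_mul (X_sub_C_ne_zero _) hq'0] at hq
      simp at hq; omega
    obtain ⟨g, u, s, h1, h2, h3, h4⟩ := ih R q' hd' (by rw [hR, hRd]) hR (hsep.of_mul_right)
      (by simp at ht0; tauto)
    refine ⟨g, u, τ ::ₘ s, ?_, h2, h3, h4⟩
    rw [h1]; simp; ring

lemma ps_double [IsAlgClosed W] (t0 : W) (P : Polynomial (PowerSeries W)) (q : W[X])
    (hdeg : (P.map (PowerSeries.constantCoeff (R := W))).natDegree = P.natDegree)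
    (hfac : P.map (PowerSeries.constantCoeff (R := W)) = (X - C t0) ^ 2 * q)
    (hsep : q.Separable) (ht0 : q.eval t0 ≠ 0)
    (hv : PowerSeries.coeff 1 (P.eval (PowerSeries.C t0)) ≠ 0) :
    ∃ (g : Polynomial (PowerSeries W)) (u : PowerSeries W) (s : Multiset (PowerSeries W)),
      P = C u * g * (s.map fun ρ => X - C ρ).prod ∧ g.Monic ∧ g.natDegree = 2 ∧
      g.map (PowerSeries.constantCoeff (R := W)) = (X - C t0) ^ 2 ∧
      Irreducible (g.map (algebraMap (PowerSeries W) (FractionRing (PowerSeries W)))) := by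
  obtain ⟨g, u, s, h1, h2, h3, h4⟩ := ps_double_aux t0 _ P q rfl hdeg hfac hsep ht0
  have hXs : ((X - C t0) ^ 2 : W[X]) ≠ 0 := pow_ne_zero _ (X_sub_C_ne_zero _)
  obtain ⟨v, g', hg', rfl⟩ := ps_monic g (by rw [h3]; exact mul_ne_zero (by simpa using h2) hXs)
    (by rw [h3, h4, natDegree_C_mul h2]; simp)
  have hv0 : PowerSeries.constantCoeff (v : PowerSeries W) ≠ 0 := (ps_isUnit_iff _).1 v.isUnit
  have hmon : (g'.map (PowerSeries.constantCoeff (R := W))).Monic := hg'.map _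
  have hred : g'.map (PowerSeries.constantCoeff (R := W)) = (X - C t0) ^ 2 := by
    have hlc := congrArg leadingCoeff h3
    rw [Polynomial.map_mul, map_C, leadingCoeff_mul, leadingCoeff_mul, hmon.leadingCoeff] at hlc
    have : ((X - C t0) ^ 2 : W[X]).leadingCoeff = 1 := ((monic_X_sub_C t0).pow 2).leadingCoeff
    rw [this] at hlc
    simp at hlc
    rw [Polynomial.map_mul, map_C, hlc] at h3
    exact mul_left_cancel₀ (by simpa using h2) h3
  have hd2 : g'.natDegree = 2 := by
    rw [← hg'.natDegree_map (PowerSeries.constantCoeff (R := W)), hred]; simp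
  refine ⟨g', v, s, h1, hg', hd2, hred, ?_⟩
  rw [← Monic.irreducible_iff_irreducible_map_fraction_map hg']
  by_contra hcon
  obtain ⟨c1, c2, hc0, hc1⟩ := (hg'.not_irreducible_iff_exists_add_mul_eq_coeff hd2).1 hcon
  have hge : g' = (X + C c1) * (X + C c2) := by
    rw [hg'.as_sum, hd2]
    simp [Finset.sum_range_succ, hc0, hc1]
    ring
  have hz : ∀ c : PowerSeries W, (X + C c) ∣ g' → PowerSeries.X ∣ (PowerSeries.C t0 + c) := by
    intro c hc
    rw [PowerSeries.X_dvd_iff]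
    have hc' : (X + C (PowerSeries.constantCoeff c)) ∣ (X - C t0) ^ 2 := by
      rw [← hred]
      simpa using Polynomial.map_dvd (PowerSeries.constantCoeff (R := W)) hc
    have := eval_dvd (x := - (PowerSeries.constantCoeff c)) hc'
    simp at this
    rw [map_add, PowerSeries.constantCoeff_C]
    linear_combination -this
  obtain ⟨d1, hd1⟩ := hz c1 (by rw [hge]; exact dvd_mul_right _ _)
  obtain ⟨d2, hd2⟩ := hz c2 (by rw [hge]; exact dvd_mul_left _ _)
  apply hv
  rw [h1, hge]
  simp only [eval_mul, eval_C, eval_add, eval_X, hd1, hd2]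
  have : ∀ a b : PowerSeries W, (v : PowerSeries W) * (PowerSeries.X * d1 * (PowerSeries.X * d2)) * b
    = PowerSeries.X ^ 2 * ((v : PowerSeries W) * d1 * d2 * b) := by intros; ring
  rw [this 0, PowerSeries.coeff_X_pow_mul']
  simp

end HenselPart

/-- Substitution `F(t, f)` with coefficients pushed along `ι`. -/
noncomputable def bs {M A : Type} [CommRing M] [CommRing A] (ι : M →+* A) (f : A[X]) :
    M[X][X] →+* A[X] := eval₂RingHom (mapRingHom ι) f

lemma bs_def {M A : Type} [CommRing M] [CommRing A] (ι : M →+* A) (f : A[X]) (F : M[X][X]) :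
    bs ι f F = eval f (F.map (mapRingHom ι)) := by
  simp [bs, eval_map]

lemma bs_map {M A B : Type} [CommRing M] [CommRing A] [CommRing B] (ι : M →+* A) (ψ : A →+* B)
    (f : A[X]) (F : M[X][X]) : (bs ι f F).map ψ = bs (ψ.comp ι) (f.map ψ) F := by
  have : (mapRingHom ψ).comp (bs ι f) = bs (ψ.comp ι) (f.map ψ) := by
    ext <;> simp [bs]
  simpa using congrArg (fun h => h F) this

lemma bs_map' {M N A : Type} [CommRing M] [CommRing A] [CommRing N] (ι : N →+* A) (ψ : M →+* N)
    (f : A[X]) (F : M[X][X]) : bs ι f (F.map (mapRingHom ψ)) = bs (ι.comp ψ) f F := by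
  have : (bs ι f).comp (mapRingHom (mapRingHom ψ)) = bs (ι.comp ψ) f := by
    ext <;> simp [bs]
  simpa using congrArg (fun h => h F) this

/-- The polynomial of degree `≤ n` with coefficients `v`. -/
noncomputable def vpoly {A : Type} [CommRing A] {n : ℕ} (v : Fin (n + 1) → A) : A[X] :=
  ∑ j : Fin (n + 1), C (v j) * X ^ (j : ℕ)

lemma vpoly_natDegree {A : Type} [CommRing A] {n : ℕ} (v : Fin (n + 1) → A) :
    (vpoly v).natDegree ≤ n := by
  apply natDegree_sum_le_of_forall_le
  intro i _
  exact (natDegree_C_mul_X_pow_le _ _).trans (Nat.lt_succ_iff.1 i.2)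

lemma vpoly_map {A B : Type} [CommRing A] [CommRing B] {n : ℕ} (v : Fin (n + 1) → A)
    (ψ : A →+* B) : (vpoly v).map ψ = vpoly (fun i => ψ (v i)) := by
  simp [vpoly, Polynomial.map_sum]

lemma vpoly_coeff {A : Type} [CommRing A] {n : ℕ} (v : Fin (n + 1) → A) (i : Fin (n + 1)) :
    (vpoly v).coeff i = v i := by
  simp only [vpoly, finsetSum_coeff, coeff_C_mul_X_pow]
  simp [Fin.val_inj]

lemma vpoly_of_coeff {A : Type} [CommRing A] {n : ℕ} (f : A[X]) (hf : f.natDegree ≤ n) :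
    vpoly (fun i : Fin (n + 1) => f.coeff i) = f := by
  conv_rhs => rw [f.as_sum_range' (n + 1) (by omega)]
  rw [vpoly, Finset.sum_range (fun i => monomial i (f.coeff i))]
  simp [C_mul_X_pow_eq_monomial]

lemma substF_map {M A : Type} [CommRing M] [CommRing A] (n : ℕ)
    (φ : MvPolynomial (Fin (n + 1)) M →+* A) (F : M[X][X]) :
    (substF n F).map φ = bs (φ.comp MvPolynomial.C) (vpoly fun i => φ (MvPolynomial.X i)) F := by
  have : substF n F = bs MvPolynomial.C (vpoly MvPolynomial.X) F := by
    rw [bs_def]; rfl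
  rw [this, bs_map, vpoly_map]

lemma substF_eq {M : Type} [CommRing M] (n : ℕ) (F : M[X][X]) :
    substF n F = bs MvPolynomial.C (vpoly MvPolynomial.X) F := by
  rw [bs_def]; rfl

lemma substF_mul {M : Type} [CommRing M] (n : ℕ) (F G : M[X][X]) :
    substF n (F * G) = substF n F * substF n G := by
  rw [substF_eq, map_mul, substF_eq, substF_eq]

/-- slope condition -/
def Slp {M : Type} [CommRing M] (n : ℕ) (F : M[X][X]) : Prop :=
  ∀ l, l ≤ F.natDegree → (F.coeff l).natDegree + l * n ≤ F.natDegree * n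

lemma Slp.mul {M : Type} [CommRing M] [IsDomain M] {n : ℕ} {F G : M[X][X]} (hF : F.Monic) (hG : G.Monic)
    (h1 : Slp n F) (h2 : Slp n G) : Slp n (F * G) := by
  intro l hl
  rw [hF.natDegree_mul hG] at hl ⊢
  have : ((F * G).coeff l).natDegree ≤ (F.natDegree + G.natDegree - l) * n := by
    rw [coeff_mul]
    apply natDegree_sum_le_of_forall_le
    rintro ⟨a, b⟩ hab
    rw [Finset.HasAntidiagonal.mem_antidiagonal] at hab
    simp only at hab ⊢
    by_cases ha : F.natDegree < a
    · simp [coeff_eq_zero_of_natDegree_lt ha]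
    by_cases hb : G.natDegree < b
    · simp [coeff_eq_zero_of_natDegree_lt hb]
    refine natDegree_mul_le.trans ?_
    have e1 := h1 a (by omega)
    have e2 := h2 b (by omega)
    subst hab
    have : (F.natDegree + G.natDegree - (a + b)) * n + (a + b) * n = (F.natDegree + G.natDegree) * n := by
      rw [← add_mul]; congr 1; omega
    rw [add_mul, add_mul] at this
    omega
  have h3 : (F.natDegree + G.natDegree - l) * n + l * n = (F.natDegree + G.natDegree) * n := by
      rw [← add_mul]; congr 1; omega
  omega

lemma Slp.prod {M : Type} [CommRing M] [IsDomain M] {n : ℕ} {ι : Type} (s : Finset ι) (F : ι → M[X][X])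
    (hF : ∀ i ∈ s, (F i).Monic) (h : ∀ i ∈ s, Slp n (F i)) : Slp n (∏ i ∈ s, F i) := by
  classical
  induction s using Finset.induction_on with
  | empty => intro l hl; simp at hl; simp [hl]
  | insert a s ha ih =>
    rw [Finset.prod_insert ha]
    refine Slp.mul (hF a (by simp)) (monic_prod_of_monic _ _ fun i hi => hF i (by simp [hi]))
      (h a (by simp)) (ih (fun i hi => hF i (by simp [hi])) fun i hi => h i (by simp [hi]))

lemma Slp.map {M N : Type} [CommRing M] [CommRing N] [IsDomain N] {n : ℕ} {F : M[X][X]} (hF : F.Monic) (ι : M →+* N)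
    (h : Slp n F) : Slp n (F.map (mapRingHom ι)) := by
  intro l hl
  rw [hF.natDegree_map] at hl ⊢
  rw [coeff_map]
  have := h l hl
  have h2 : ((mapRingHom ι) (F.coeff l)).natDegree ≤ (F.coeff l).natDegree := natDegree_map_le
  omega

lemma slopeX_slp {K : Type} [Field K] (n : ℕ) (F : K[X][X]) (hF : F.Monic)
    (h : slopeX F ≤ ((n : ℚ) : WithBot ℚ)) : Slp n F := by
  intro l hl
  rcases hl.lt_or_eq with hl | rfl
  swap
  · have : F.coeff F.natDegree = 1 := hF
    simp [this]
  by_cases h0 : F.coeff l = 0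
  · simp [h0]; exact Nat.mul_le_mul_right _ hl.le
  have := Finset.sup_le_iff.1 h (F.natDegree - l) (by simp; omega)
  have e : F.natDegree - (F.natDegree - l) = l := by omega
  rw [e, degree_eq_natDegree h0] at this
  have this : (((F.coeff l).natDegree : ℚ) / ((F.natDegree - l : ℕ) : ℚ)) ≤ n := by
    have h2 : WithBot.map (fun d : ℕ => (d:ℚ) / ((F.natDegree - l : ℕ) : ℚ)) (((F.coeff l).natDegree : ℕ) : WithBot ℕ) = (((F.coeff l).natDegree : ℚ) / ((F.natDegree - l : ℕ) : ℚ) : ℚ) := rfl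
    rw [h2] at this
    exact WithBot.coe_le_coe.1 this
  rw [div_le_iff₀ (by exact_mod_cast (by omega))] at this
  have h3 : (F.coeff l).natDegree ≤ n * (F.natDegree - l) := by exact_mod_cast this
  have h4 : n * (F.natDegree - l) + l * n = F.natDegree * n := by
    rw [mul_comm n, ← add_mul]; congr 1; omega
  omega

/-- leading form -/
noncomputable def hpoly {M : Type} [CommRing M] (n : ℕ) (F : M[X][X]) : M[X] :=
  ∑ l ∈ Finset.range (F.natDegree + 1), C ((F.coeff l).coeff ((F.natDegree - l) * n)) * X ^ l

lemma hpoly_ne_zero {M : Type} [CommRing M] [Nontrivial M] (n : ℕ) (F : M[X][X]) (hF : F.Monic) :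
    hpoly n F ≠ 0 := by
  intro h
  have := congrArg (fun p => p.coeff F.natDegree) h
  have h1 : F.coeff F.natDegree = 1 := hF
  simp [hpoly, finsetSum_coeff, coeff_C_mul_X_pow, h1] at this

lemma coeff_mul_top {A : Type} [CommRing A] {p q : A[X]} {a b : ℕ} (hp : p.natDegree ≤ a)
    (hq : q.natDegree ≤ b) : (p * q).coeff (a + b) = p.coeff a * q.coeff b := by
  exact coeff_mul_add_eq_of_natDegree_le hp hq

lemma bs_natDegree {M A : Type} [CommRing M] [CommRing A] {n : ℕ} {F : M[X][X]} (hF : Slp n F)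
    (ι : M →+* A) (f : A[X]) (hf : f.natDegree ≤ n) : (bs ι f F).natDegree ≤ F.natDegree * n := by
  rw [bs, coe_eval₂RingHom, eval₂_eq_sum_range]
  apply natDegree_sum_le_of_forall_le
  intro l hl
  simp only [Finset.mem_range] at hl
  have := hF l (by omega)
  refine natDegree_mul_le.trans ?_
  have h2 : ((mapRingHom ι) (F.coeff l)).natDegree ≤ (F.coeff l).natDegree := natDegree_map_le
  have h3 : (f ^ l).natDegree ≤ l * n := natDegree_pow_le.trans (Nat.mul_le_mul_left _ hf)
  omega

lemma bs_coeff_top {M A : Type} [CommRing M] [CommRing A] {n : ℕ} {F : M[X][X]} (hF : Slp n F)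
    (ι : M →+* A) (f : A[X]) (hf : f.natDegree ≤ n) :
    (bs ι f F).coeff (F.natDegree * n) = (hpoly n F).eval₂ ι (f.coeff n) := by
  rw [bs, coe_eval₂RingHom, eval₂_eq_sum_range, finsetSum_coeff, hpoly, eval₂_finsetSum]
  apply Finset.sum_congr rfl
  intro l hl
  simp only [Finset.mem_range] at hl
  have := hF l (by omega)
  have h2 : ((mapRingHom ι) (F.coeff l)).natDegree ≤ (F.coeff l).natDegree := natDegree_map_le
  have h3 : (f ^ l).natDegree ≤ l * n := natDegree_pow_le.trans (Nat.mul_le_mul_left _ hf)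
  have h4 : F.natDegree * n = (F.natDegree - l) * n + l * n := by
    rw [← add_mul]; congr 1; omega
  rw [h4, coeff_mul_top (by omega) h3, coeff_pow_of_natDegree_le hf]
  simp

/-- Degree is preserved under specialization. -/
lemma bs_natDegree_map {M A B : Type} [CommRing M] [CommRing A] [CommRing B] {n : ℕ}
    {F : M[X][X]} (hF : Slp n F) (ι : M →+* A) (f : A[X]) (hf : f.natDegree ≤ n) (ψ : A →+* B)
    (h : (hpoly n F).eval₂ (ψ.comp ι) (ψ (f.coeff n)) ≠ 0) :
    (bs ι f F).natDegree = F.natDegree * n ∧ ((bs ι f F).map ψ).natDegree = F.natDegree * n := by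
  have h1 := bs_natDegree hF ι f hf
  have h2 : ((bs ι f F).map ψ).coeff (F.natDegree * n) ≠ 0 := by
    rw [bs_map, bs_coeff_top hF _ _ (natDegree_map_le.trans hf), coeff_map]; exact h
  have h3 := le_natDegree_of_ne_zero h2
  have h4 : ((bs ι f F).map ψ).natDegree ≤ (bs ι f F).natDegree := natDegree_map_le
  omega

lemma natDegree_factor_map {A B : Type} [CommRing A] [IsDomain A] [CommRing B] [IsDomain B]
    (ψ : A →+* B) (P Q : A[X]) (h0 : (P * Q).map ψ ≠ 0)
    (h : ((P * Q).map ψ).natDegree = (P * Q).natDegree) : (P.map ψ).natDegree = P.natDegree := by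
  have hP : P * Q ≠ 0 := by rintro h; simp [h] at h0
  rw [Polynomial.map_mul] at h h0
  rw [natDegree_mul (left_ne_zero_of_mul h0) (right_ne_zero_of_mul h0),
    natDegree_mul (left_ne_zero_of_mul hP) (right_ne_zero_of_mul hP)] at h
  have h1 : (P.map ψ).natDegree ≤ P.natDegree := natDegree_map_le
  have h2 : (Q.map ψ).natDegree ≤ Q.natDegree := natDegree_map_le
  omega

/-- evaluation of substituted polynomial -/
lemma bs_eval {M A : Type} [CommRing M] [CommRing A] (ι : M →+* A) (f : A[X]) (F : M[X][X]) (t : A) :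
    (bs ι f F).eval t = F.eval₂ (eval₂RingHom ι t) (f.eval t) := by
  have : (evalRingHom t).comp (bs ι f) = eval₂RingHom (eval₂RingHom ι t) (f.eval t) := by
    ext <;> simp [bs]
  simpa using congrArg (fun h => h F) this

section Emb
variable {M M1 W : Type} [Field M] [Field M1] [Field W] {n : ℕ}

/-- the generic deformation of `f0` -/
noncomputable def emb (ι : M →+* M1) (θ : MvPolynomial (Fin (n + 1)) M1 →+* W) (f0 : M1[X]) :
    MvPolynomial (Fin (n + 1)) M →+* PowerSeries W :=
  MvPolynomial.eval₂Hom ((PowerSeries.C (R := W)).comp (θ.comp (MvPolynomial.C.comp ι)))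
    (fun i => PowerSeries.C (θ (MvPolynomial.C (f0.coeff i))) +
      PowerSeries.X * PowerSeries.C (θ (MvPolynomial.X i)))

lemma emb_injective (ι : M →+* M1) (θ : MvPolynomial (Fin (n + 1)) M1 →+* W)
    (hθ : Function.Injective θ) (f0 : M1[X]) : Function.Injective (emb ι θ f0) := by
  let φ' : MvPolynomial (Fin (n + 1)) M →+* (MvPolynomial (Fin (n + 1)) M1)[X] :=
    MvPolynomial.eval₂Hom (Polynomial.C.comp (MvPolynomial.C.comp ι))
      (fun i => C (MvPolynomial.C (f0.coeff i)) + X * C (MvPolynomial.X i))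
  have h1 : emb ι θ f0 = (Polynomial.coeToPowerSeries.ringHom).comp ((mapRingHom θ).comp φ') := by
    apply MvPolynomial.ringHom_ext
    · intro r; simp [emb, φ']
    · intro i; simp [emb, φ']; exact mul_comm _ _
  let tr : MvPolynomial (Fin (n + 1)) M1 →+* MvPolynomial (Fin (n + 1)) M1 :=
    MvPolynomial.eval₂Hom MvPolynomial.C (fun i => MvPolynomial.C (f0.coeff i) + MvPolynomial.X i)
  let tr' : MvPolynomial (Fin (n + 1)) M1 →+* MvPolynomial (Fin (n + 1)) M1 :=
    MvPolynomial.eval₂Hom MvPolynomial.C (fun i => MvPolynomial.X i - MvPolynomial.C (f0.coeff i))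
  have h2 : tr'.comp tr = RingHom.id _ := by
    apply MvPolynomial.ringHom_ext
    · intro r; simp [tr, tr']
    · intro i; simp [tr, tr']
  have htr : Function.Injective tr := by
    apply Function.LeftInverse.injective (g := tr')
    intro x; exact congrArg (fun h => h x) h2
  have h3 : (evalRingHom (1 : MvPolynomial (Fin (n + 1)) M1)).comp φ' =
      tr.comp (MvPolynomial.map ι) := by
    apply MvPolynomial.ringHom_ext
    · intro r; simp [tr, φ']
    · intro i; simp [tr, φ']
  have h4 : Function.Injective φ' := by
    have : Function.Injective ((evalRingHom (1 : MvPolynomial (Fin (n + 1)) M1)).comp φ') := by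
      rw [h3]; exact htr.comp (MvPolynomial.map_injective _ ι.injective)
    exact Function.Injective.of_comp this
  rw [h1]
  exact (Polynomial.coe_injective W).comp ((Polynomial.map_injective θ hθ).comp h4)

lemma emb_const (ι : M →+* M1) (θ : MvPolynomial (Fin (n + 1)) M1 →+* W)
    (f0 : M1[X]) (hf : f0.natDegree ≤ n) (F : M[X][X]) :
    ((substF n F).map (emb ι θ f0)).map (PowerSeries.constantCoeff (R := W)) =
      (bs ι f0 F).map (θ.comp MvPolynomial.C) := by
  rw [Polynomial.map_map, substF_map, bs_map]
  congr 1
  · congr 1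
    · ext r; simp [emb]
    · conv_rhs => rw [← vpoly_of_coeff f0 hf]
      rw [vpoly_map]
      congr 1
      ext i; simp [emb]

lemma emb_deg {Φ : M[X][X]} (hS : Slp n Φ)
    (ι : M →+* M1) (θ : MvPolynomial (Fin (n + 1)) M1 →+* W)
    (f0 : M1[X]) (h0 : (hpoly n Φ).eval₂ ι (f0.coeff n) ≠ 0) :
    (((substF n Φ).map (emb ι θ f0)).map (PowerSeries.constantCoeff (R := W))).natDegree =
    ((substF n Φ).map (emb ι θ f0)).natDegree := by
  rw [substF_map]
  obtain ⟨h1, h2⟩ := bs_natDegree_map hS ((emb ι θ f0).comp MvPolynomial.C)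
    (vpoly fun i => emb ι θ f0 (MvPolynomial.X i)) (vpoly_natDegree _)
    (PowerSeries.constantCoeff (R := W)) (by
      have e := vpoly_coeff (fun i => emb ι θ f0 (MvPolynomial.X i)) (Fin.last n)
      rw [Fin.val_last] at e
      rw [e]
      have e2 : PowerSeries.constantCoeff (emb ι θ f0 (MvPolynomial.X (Fin.last n))) =
        (θ.comp MvPolynomial.C) (f0.coeff n) := by simp [emb]
      have e3 : (PowerSeries.constantCoeff (R := W)).comp ((emb ι θ f0).comp MvPolynomial.C) =
        (θ.comp MvPolynomial.C).comp ι := by ext; simp [emb]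
      rw [e2, e3, ← hom_eval₂]
      intro hh
      exact h0 ((θ.comp MvPolynomial.C).injective (by rw [hh, map_zero])))
  rw [h1, h2]

end Emb

lemma bs_expand {M A : Type} [CommRing M] [CommRing A] (ι : M →+* A) (G : M[X][X])
    (a w γ : M[X]) (h : G.eval a = w * γ) (b : A[X]) :
    ∃ k, bs ι (a.map ι + w.map ι * b) G =
      w.map ι * (γ.map ι + ((derivative G).eval a).map ι * b + w.map ι * k) := by
  obtain ⟨k, hk⟩ := (G.map (mapRingHom ι)).binomExpansion (a.map ι) (w.map ι * b)
  refine ⟨k * b ^ 2, ?_⟩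
  rw [bs_def, hk]
  have e1 : eval (Polynomial.map ι a) (Polynomial.map (mapRingHom ι) G) = (G.eval a).map ι := by
    have := (eval_map_apply (mapRingHom ι) (p := G) a)
    simpa using this
  have e2 : eval (Polynomial.map ι a) (derivative (Polynomial.map (mapRingHom ι) G)) = ((derivative G).eval a).map ι := by
    rw [derivative_map]
    have := (eval_map_apply (mapRingHom ι) (p := derivative G) a)
    simpa using this
  rw [e1, e2, h, Polynomial.map_mul]; ring

lemma eval_eval_map {M : Type} [CommRing M] (G : M[X][X]) (t x : M) :
    (G.map (evalRingHom t)).eval x = (G.eval (C x)).eval t := by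
  have := eval_map_apply (evalRingHom t) (p := G) (C x)
  simpa using this

structure Good {M : Type} [Field M] (n : ℕ) (Φ g g' : M[X][X]) : Prop where
  fac : Φ = g * g'
  monΦ : Φ.Monic
  mon : g.Monic
  irr : Irreducible g
  slp : Slp n Φ
  bz : ∃ (a b : M[X][X]) (c : M[X]), c ≠ 0 ∧ a * Φ + b * derivative Φ = C c

variable {M : Type} [Field M] [IsAlgClosed M] {n : ℕ} {Φ g g' : M[X][X]}

lemma Good.pos (h : Good n Φ g g') : 0 < g.natDegree := by
  rw [Nat.pos_iff_ne_zero]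
  intro h0
  exact h.irr.not_isUnit (by rw [(Monic.natDegree_eq_zero h.mon).1 h0]; exact isUnit_one)

lemma Good.point (h : Good n Φ g g') : ∃ t x : M, (g.eval (C x)).eval t = 0 ∧
    ((derivative g).eval (C x)).eval t ≠ 0 ∧ (g'.eval (C x)).eval t ≠ 0 ∧
    ((derivative Φ).eval (C x)).eval t ≠ 0 := by
  obtain ⟨a, b, c, hc, hbz⟩ := h.bz
  have : Infinite M := IsAlgClosed.instInfinite
  obtain ⟨t, ht⟩ : ∃ t, c.eval t ≠ 0 := by
    by_contra! hh
    exact hc (Polynomial.funext (by simpa using hh))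
  obtain ⟨x, hx⟩ := IsAlgClosed.exists_root (g.map (evalRingHom t)) (by
    rw [(h.mon.degree_map _), degree_eq_natDegree h.mon.ne_zero]
    have := h.pos
    exact_mod_cast this.ne')
  have hx0 : (g.eval (C x)).eval t = 0 := by rw [← eval_eval_map]; exact hx
  have hΦ : ((derivative Φ).eval (C x)).eval t ≠ 0 := by
    intro h0
    have h2 := congrArg (fun p => (p.eval (C x)).eval t) hbz
    simp [h0, h.fac, hx0] at h2
    rw [h.fac] at h0
    apply ht
    rw [← h2]
    simp [hx0] at h0 
    simp [h0]
  refine ⟨t, x, hx0, ?_, ?_, hΦ⟩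
  · intro h0; apply hΦ; rw [h.fac]; simp [h0, hx0]
  · intro h0; apply hΦ; rw [h.fac]; simp [h0, hx0]

lemma Good.expand {M : Type} [Field M] (G : M[X][X]) {t x : M} (h : (G.eval (C x)).eval t = 0) :
    ∃ γ, G.eval (C x) = (X - C t) * γ := dvd_iff_isRoot.2 h

lemma Good.deriv (h : Good n Φ g g') (hn : 1 ≤ n) : derivative (substF n g) ≠ 0 := by
  obtain ⟨t, x, h0, h1, -⟩ := h.point
  obtain ⟨γ, hγ⟩ := Good.expand g h0
  intro hd
  obtain ⟨l, hl⟩ : ∃ l : M, γ.eval t + ((derivative g).eval (C x)).eval t * l ≠ 0 := by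
    by_cases hh : γ.eval t = 0
    · exact ⟨1, by simpa [hh] using h1⟩
    · exact ⟨0, by simpa using hh⟩
  obtain ⟨k, hk⟩ := bs_expand (RingHom.id M) g (C x) (X - C t) γ hγ (C l)
  set f : M[X] := (C x).map (RingHom.id M) + (X - C t).map (RingHom.id M) * C l with hf
  have hfd : f.natDegree ≤ n := by
    refine le_trans ?_ hn
    rw [hf]
    simp only [Polynomial.map_id]
    compute_degree
  have e : (substF n g).map (MvPolynomial.eval₂Hom (RingHom.id M) fun i : Fin (n+1) => f.coeff i) = bs (RingHom.id M) f g := by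
    rw [substF_map]
    congr 2
    · ext; simp
    · conv_rhs => rw [← vpoly_of_coeff f hfd]
      simp
  have := congrArg (fun p => (derivative p).eval t) (e.trans hk)
  simp only [derivative_map, hd] at this
  simp at this
  exact hl this.symm

lemma gauss_map (G : M[X][X]) (hG : Irreducible G) (h : G.natDegree ≠ 0) :
    Irreducible (G.map (algebraMap M[X] (FractionRing M[X]))) :=
  (hG.isPrimitive h).irreducible_iff_irreducible_map_fraction_map.1 hG

lemma irr_frac_mv {k : Type} [Field k] {σ : Type} (P : k[X]) (hP : Irreducible P) :
    Irreducible (P.map ((algebraMap (MvPolynomial σ k) (FractionRing (MvPolynomial σ k))).comp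
      MvPolynomial.C)) := by
  obtain ⟨u, hu, Q, hQ, hPQ⟩ : ∃ u : k, u ≠ 0 ∧ ∃ Q : k[X], Q.Monic ∧ P = C u * Q := by
    refine ⟨P.leadingCoeff, by simpa using hP.ne_zero, P * C (P.leadingCoeff)⁻¹,
      monic_mul_leadingCoeff_inv hP.ne_zero, ?_⟩
    have : P.leadingCoeff ≠ 0 := by simpa using hP.ne_zero
    rw [mul_comm P, ← mul_assoc, ← C_mul, mul_inv_cancel₀ this]; simp
  subst hPQ
  rw [irreducible_isUnit_mul (isUnit_C.2 hu.isUnit)] at hP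
  rw [Polynomial.map_mul, map_C, irreducible_isUnit_mul (isUnit_C.2 (hu.isUnit.map _))]
  rw [← Polynomial.map_map]
  have hm := hQ.map (MvPolynomial.C (σ := σ))
  rw [← (Monic.irreducible_iff_irreducible_map_fraction_map hm)]
  apply Monic.irreducible_of_irreducible_map (MvPolynomial.constantCoeff) _ hm
  rw [Polynomial.map_map]
  convert hP
  convert Polynomial.map_id
  ext; simp

lemma hpoly_exists (h : Good n Φ g g') : ∃ β : M, (hpoly n Φ).eval β ≠ 0 := by
  have : Infinite M := IsAlgClosed.instInfinite
  by_contra! hh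
  exact hpoly_ne_zero n Φ h.monΦ (Polynomial.funext (by simpa using hh))

lemma Good.bs_ne_zero (h : Good n Φ g g') {A : Type} [Field A] (ι : M →+* A) (f : A[X])
    (hf : f.natDegree ≤ n) (h0 : (hpoly n Φ).eval₂ ι (f.coeff n) ≠ 0) : bs ι f Φ ≠ 0 := by
  intro hh
  apply h0
  rw [← bs_coeff_top h.slp ι f hf, hh]; simp

lemma Good.geo_deg (h : Good n Φ g g') (hn : 1 ≤ n)  {M1 W : Type} [Field M1] [Field W]
    (ι : M →+* M1) (θ : MvPolynomial (Fin (n + 1)) M1 →+* W) (hθ : Function.Injective θ)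
    (f0 : M1[X]) (hf : f0.natDegree ≤ n) (h0 : (hpoly n Φ).eval₂ ι (f0.coeff n) ≠ 0) :
    (((substF n g).map (emb ι θ f0)).map (PowerSeries.constantCoeff (R := W))).natDegree =
    ((substF n g).map (emb ι θ f0)).natDegree ∧ 0 < (bs ι f0 g).natDegree := by
  have h1 := emb_deg h.slp ι θ f0 h0
  have h2 : ((substF n Φ).map (emb ι θ f0)).map (PowerSeries.constantCoeff (R := W)) ≠ 0 := by
    rw [emb_const _ _ _ hf]
    have := h.bs_ne_zero ι f0 hf h0
    rwa [Ne, Polynomial.map_eq_zero]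
  rw [h.fac, substF_mul, Polynomial.map_mul] at h1 h2
  have h3 := natDegree_factor_map _ _ _ h2 h1
  refine ⟨h3, ?_⟩
  rw [emb_const _ _ _ hf, natDegree_map, natDegree_map_eq_of_injective (emb_injective ι θ hθ f0)] at h3
  rw [h3, Nat.pos_iff_ne_zero]
  intro hh
  obtain ⟨c, hc⟩ := natDegree_eq_zero.1 hh
  apply h.deriv hn
  rw [← hc]; simp

lemma Good.geoT (h : Good n Φ g g') (hn : 1 ≤ n) : ∃ (K1 : Type) (_ : Field K1)
    (φ : MvPolynomial (Fin (n + 1)) M →+* K1), Function.Injective φ ∧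
      Irreducible ((substF n g).map φ) := by
  obtain ⟨β, hβ⟩ := hpoly_exists h
  let M1 := FractionRing M[X]
  let ι : M →+* M1 := (algebraMap M[X] M1).comp C
  let f : M[X][X] := C X + C (C β) * X ^ n
  have hfd : f.natDegree ≤ n := by
    simp only [f]; compute_degree
  have hfc : f.coeff n = C β := by
    simp [f, coeff_C, show n ≠ 0 by omega]
  let f0 : M1[X] := f.map (algebraMap M[X] M1)
  have hf0 : f0.natDegree ≤ n := natDegree_map_le.trans hfd
  have e1 : bs C f g = Bivariate.swap (g.comp (X + C (C β * X ^ n))) := by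
    have : bs C f = ((Bivariate.swap (R := M)).toRingEquiv.toRingHom).comp (compRingHom (X + C (C β * X ^ n))) := by
      ext : 3 <;> simp [bs, f, Bivariate.swap_C_C, Bivariate.swap_X, Bivariate.swap_Y]
    simpa using congrArg (fun h => h g) this
  have e2 : Irreducible (bs C f g) := by
    rw [e1, MulEquiv.irreducible_iff]
    have e3 : g.comp (X + C (C β * X ^ n)) = algEquivAevalXAddC (C β * X ^ n) g := by
      simp [comp, algEquivAevalXAddC, aeval_def]
    rw [e3, MulEquiv.irreducible_iff]
    exact h.irr
  let W := FractionRing (MvPolynomial (Fin (n + 1)) M1)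
  let θ : MvPolynomial (Fin (n + 1)) M1 →+* W := algebraMap _ _
  have hθ : Function.Injective θ := IsFractionRing.injective _ _
  have h0 : (hpoly n Φ).eval₂ ι (f0.coeff n) ≠ 0 := by
    have : f0.coeff n = ι β := by simp [f0, hfc, ι]
    rw [this, eval₂_at_apply]
    intro hh
    exact hβ (ι.injective (by rw [hh, map_zero]))
  obtain ⟨h1, h2⟩ := h.geo_deg hn ι θ hθ f0 hf0 h0
  have e4 : bs ι f0 g = (bs C f g).map (algebraMap M[X] M1) := by rw [bs_map]
  have e5 : Irreducible (bs ι f0 g) := by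
    rw [e4]
    apply gauss_map _ e2
    intro hh
    rw [e4] at h2
    have := natDegree_map_le (p := bs C f g) (f := algebraMap M[X] M1)
    omega
  refine ⟨FractionRing (PowerSeries W), inferInstance, (algebraMap _ _).comp (emb ι θ f0),
    (IsFractionRing.injective _ _).comp (emb_injective ι θ hθ f0), ?_⟩
  rw [← Polynomial.map_map]
  apply ps_irr_of_red _ _ h1
  rw [emb_const _ _ _ hf0]
  exact irr_frac_mv _ e5

section GeoD
variable {M : Type} [Field M] [IsAlgClosed M] {n : ℕ} {Φ g g' : M[X][X]}

lemma Good.irrD (h : Good n Φ g g') (t1 x1 : M) (ψ : M[X])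
    (Q : M[X][X]) (hQ : g.comp (C (C x1) + C (X - C t1) * (X + C ψ)) = C (X - C t1) * Q)
    (hQ0 : Q.map (evalRingHom t1) ≠ 0) : Irreducible Q := by
  have hprim : Q.IsPrimitive := by
    intro r hr
    have h1 : r ∣ (X - C t1) ^ g.natDegree := by
      have h2 : C r ∣ g.comp (C (C x1) + C (X - C t1) * (X + C ψ)) := by
        rw [hQ]; exact Dvd.dvd.mul_left hr _
      have h3 : C (C x1) + C (X - C t1) * (X + C ψ) =
          C (X - C t1) * X + C (C x1 + (X - C t1) * ψ) := by simp; ring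
      have h4 := (C_dvd_iff_dvd_coeff _ _).1 h2 (g.comp (C (C x1) + C (X - C t1) * (X + C ψ))).natDegree
      rw [coeff_natDegree, h3, leadingCoeff_comp, h.mon.leadingCoeff, leadingCoeff_linear (X_sub_C_ne_zero t1), one_mul] at h4
      · exact h4
      · rw [natDegree_linear (X_sub_C_ne_zero t1)]; simp
    obtain ⟨i, -, hi⟩ := (dvd_prime_pow (prime_X_sub_C t1) _).1 h1
    rcases Nat.eq_zero_or_pos i with rfl | hi0
    · rw [pow_zero, associated_one_iff_isUnit] at hi; exact hi
    · exfalso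
      apply hQ0
      have h5 : (X - C t1) ∣ r := (dvd_pow_self _ hi0.ne').trans hi.symm.dvd
      have h6 : C (X - C t1) ∣ Q := (_root_.map_dvd C h5).trans hr
      obtain ⟨k, rfl⟩ := h6
      simp
  rw [hprim.irreducible_iff_irreducible_map_fraction_map (K := FractionRing M[X])]
  set K := FractionRing M[X]
  have ha : algebraMap M[X] K (X - C t1) ≠ 0 := by
    intro hh
    exact X_sub_C_ne_zero t1 (IsFractionRing.injective M[X] K (by rw [hh, map_zero]))
  have hg : Irreducible (g.map (algebraMap M[X] K)) :=
    (Monic.irreducible_iff_irreducible_map_fraction_map h.mon).1 h.irr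
  have := invertibleOfNonzero ha
  have hg2 : Irreducible (algEquivCMulXAddC (algebraMap M[X] K (X - C t1))
      (algebraMap M[X] K (C x1 + (X - C t1) * ψ)) (g.map (algebraMap M[X] K))) := by
    rw [MulEquiv.irreducible_iff]; exact hg
  have h7 : algEquivCMulXAddC (algebraMap M[X] K (X - C t1))
      (algebraMap M[X] K (C x1 + (X - C t1) * ψ)) (g.map (algebraMap M[X] K)) =
      (g.comp (C (C x1) + C (X - C t1) * (X + C ψ))).map (algebraMap M[X] K) := by
    rw [Polynomial.map_comp]
    simp only [algEquivCMulXAddC_apply, ← comp_eq_aeval]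
    congr 1
    simp
    ring
  rw [h7, hQ, Polynomial.map_mul, map_C, irreducible_isUnit_mul (isUnit_C.2 ha.isUnit)] at hg2
  exact hg2

lemma Good.geoD (h : Good n Φ g g') (hn : 3 ≤ n) : ∃ (K1 : Type) (_ : Field K1)
    (φ : MvPolynomial (Fin (n + 1)) M →+* K1), Function.Injective φ ∧
      ∃ (τ : K1) (R : K1[X]), (substF n g).map φ = (X - C τ) * R ∧ (Irreducible R ∨ R.natDegree = 0) := by
  obtain ⟨β, hβ⟩ := hpoly_exists h
  obtain ⟨t1, x1, hp0, hp1, -⟩ := h.point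
  obtain ⟨γ, hγ⟩ := Good.expand g hp0
  let M1 := FractionRing M[X]
  let ι : M →+* M1 := (algebraMap M[X] M1).comp C
  let b : M[X][X] := C X + C (C β) * X ^ (n - 1)
  obtain ⟨k, hk⟩ := bs_expand (C : M →+* M[X]) g (C x1) (X - C t1) γ hγ b
  set f : M[X][X] := (C x1).map C + (X - C t1).map C * b with hf
  set Qs : M[X][X] := γ.map C + ((derivative g).eval (C x1)).map C * b + (X - C t1).map C * k with hQs
  have hfd : f.natDegree ≤ n := by
    simp only [hf, b]
    have : n = 1 + (n - 1) := by omega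
    simp only [map_C, Polynomial.map_sub, map_X]
    refine (natDegree_add_le _ _).trans (max_le (by simp) (natDegree_mul_le.trans ?_))
    have h1 : (X - C (C t1) : M[X][X]).natDegree ≤ 1 := by simp
    have h2 : (C X + C (C β) * X ^ (n - 1) : M[X][X]).natDegree ≤ n - 1 := by compute_degree
    omega
  have hfc : f.coeff n = C β := by
    obtain ⟨m, rfl⟩ : ∃ m, n = m + 3 := ⟨n - 3, by omega⟩
    simp [hf, b, sub_mul, mul_add, coeff_C, coeff_X]
  let f0 : M1[X] := f.map (algebraMap M[X] M1)
  have hf0 : f0.natDegree ≤ n := natDegree_map_le.trans hfd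
  set p : M[X][X] := (C (C x1) + C (X - C t1) * (X + C (C β * X ^ (n - 1)))) with hp
  have e1 : bs C f g = Bivariate.swap (g.comp p) := by
    have : bs C f = ((Bivariate.swap (R := M)).toRingEquiv.toRingHom).comp (compRingHom p) := by
      ext : 3 <;> simp [bs, hf, hp, b, Bivariate.swap_C_C, Bivariate.swap_X, Bivariate.swap_Y]
    simpa using congrArg (fun h => h g) this
  have e2 : g.comp p = C (X - C t1) * Bivariate.swap Qs := by
    rw [← Bivariate.swap_swap_apply (g.comp p), ← e1, hk, map_mul, Bivariate.swap_map_C]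
  have e3 : Irreducible Qs := by
    have := h.irrD t1 x1 _ _ e2 (by
      intro hh
      have hv : (Bivariate.swap Qs).map (evalRingHom t1) = C (γ.eval t1) +
          C (((derivative g).eval (C x1)).eval t1) * (X + C (β * t1 ^ (n - 1))) := by
        simp [hQs, Bivariate.swap_map_C, b, Bivariate.swap_C_C, Bivariate.swap_X, Bivariate.swap_Y]
      rw [hv] at hh
      have := congrArg (fun q => q.coeff 1) hh
      simp [-C_mul, -C_pow, -map_mul, -map_pow, coeff_C] at this
      exact hp1 this)
    rwa [MulEquiv.irreducible_iff] at this
  let W := FractionRing (MvPolynomial (Fin (n + 1)) M1)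
  let θ : MvPolynomial (Fin (n + 1)) M1 →+* W := algebraMap _ _
  have hθ : Function.Injective θ := IsFractionRing.injective _ _
  have h0 : (hpoly n Φ).eval₂ ι (f0.coeff n) ≠ 0 := by
    have : f0.coeff n = ι β := by simp [f0, hfc, ι]
    rw [this, eval₂_at_apply]
    intro hh
    exact hβ (ι.injective (by rw [hh, map_zero]))
  obtain ⟨h1, h2⟩ := h.geo_deg (by omega) ι θ hθ f0 hf0 h0
  have e4 : bs ι f0 g = (X - C (ι t1)) * Qs.map (algebraMap M[X] M1) := by
    have : bs ι f0 g = (bs C f g).map (algebraMap M[X] M1) := by rw [bs_map]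
    rw [this, hk]
    simp [ι]
  have e5 : Qs.eval (C t1) ≠ 0 := by
    intro hh
    have hv : Qs.eval (C t1) = C (γ.eval t1) +
        C (((derivative g).eval (C x1)).eval t1) * (X + C (β * t1 ^ (n - 1))) := by
      simp [hQs, b, eval_map, eval₂_at_apply]
    rw [hv] at hh
    have := congrArg (fun q => q.coeff 1) hh
    simp [-C_mul, -C_pow, -map_mul, -map_pow, coeff_C] at this
    exact hp1 this
  obtain ⟨τ, R, hR1, hR2, hR3⟩ := ps_factor_root ((substF n g).map (emb ι θ f0)) (θ (MvPolynomial.C (ι t1)))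
    ((Qs.map (algebraMap M[X] M1)).map (θ.comp MvPolynomial.C)) h1 (by
      rw [emb_const _ _ _ hf0, e4]; simp) (by
      rw [eval_map, ← RingHom.comp_apply, eval₂_at_apply]
      have e6 : eval (ι t1) (Qs.map (algebraMap M[X] M1)) = algebraMap M[X] M1 (Qs.eval (C t1)) := by
        simp only [ι, RingHom.comp_apply, eval_map, eval₂_at_apply]
      rw [e6]
      intro hh
      apply e5
      apply IsFractionRing.injective M[X] M1
      apply (θ.comp MvPolynomial.C).injective
      rw [hh]; simp)
  refine ⟨FractionRing (PowerSeries W), inferInstance, (algebraMap _ _).comp (emb ι θ f0),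
    (IsFractionRing.injective _ _).comp (emb_injective ι θ hθ f0), algebraMap _ _ τ,
    R.map (algebraMap _ _), ?_, ?_⟩
  · rw [← Polynomial.map_map, hR1]; simp
  · by_cases hd : Qs.natDegree = 0
    · right
      have h3 : (R.map (algebraMap (PowerSeries W) (FractionRing (PowerSeries W)))).natDegree ≤ _ := natDegree_map_le
      have h5 : ((Qs.map (algebraMap M[X] M1)).map (θ.comp MvPolynomial.C)).natDegree ≤ _ := natDegree_map_le
      have h4 : (Qs.map (algebraMap M[X] M1)).natDegree ≤ _ := natDegree_map_le
      omega
    · left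
      apply ps_irr_of_red _ _ (by rw [hR2, hR3])
      rw [hR2]
      exact irr_frac_mv _ (gauss_map _ e3 hd)

end GeoD

lemma algdep_two {M V : Type} [Field M] [Field V] [Algebra M V] (b0 b1 t : V)
    (hb : AlgebraicIndependent M ![b0, b1])
    (h0 : IsAlgebraic (Algebra.adjoin M {t}) b0) (h1 : IsAlgebraic (Algebra.adjoin M {t}) b1) :
    False := by
  have hne : b0 ≠ b1 := by
    intro h
    have := hb.injective (a₁ := 0) (a₂ := 1) (by simpa using h)
    simp at this
  have hI : (AlgebraicIndependent.matroid M V).Indep {b0, b1} := by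
    rw [AlgebraicIndependent.matroid_indep_iff]
    have := hb.to_subtype_range
    have e : Set.range ![b0, b1] = {b0, b1} := by
      simp [Set.pair_comm]
    rw [e] at this
    exact this
  have hsub : {b0, b1} ⊆ (AlgebraicIndependent.matroid M V).closure {t} := by
    rw [AlgebraicIndependent.matroid_closure_eq]
    intro x hx
    rcases hx with rfl | rfl
    · exact h0
    · exact h1
  have h2 := (AlgebraicIndependent.matroid M V).eRk_mono hsub
  rw [Matroid.eRk_closure_eq, hI.eRk_eq_encard, Set.encard_pair hne] at h2
  have h3 := h2.trans ((AlgebraicIndependent.matroid M V).eRk_le_encard {t})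
  rw [Set.encard_singleton] at h3
  norm_num at h3

lemma eval_eval_hom {A B : Type} [CommRing A] [CommRing B] (i : A →+* B) (G : A[X][X]) (x t : A) :
    ((G.map (mapRingHom i)).eval (C (i x))).eval (i t) = i ((G.eval (C x)).eval t) := by
  have h1 : C (i x) = mapRingHom i (C x) := by simp
  rw [h1, eval_map_apply]
  simp [eval_map_apply]

lemma eval_eval_hom' {A B : Type} [CommRing A] [CommRing B] (i : A →+* B) (G : A[X][X]) (x t : A) :
    (derivative ((G.map (mapRingHom i)).eval (C (i x)))).eval (i t) =
      i ((derivative (G.eval (C x))).eval t) := by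
  have h1 : C (i x) = mapRingHom i (C x) := by simp
  rw [h1, eval_map_apply]
  simp [eval_map_apply, derivative_map]

lemma lemN {M V : Type} [Field M] [IsAlgClosed M] [Field V] [Algebra M V] (b0 b1 : V)
    (hb : AlgebraicIndependent M ![b0, b1]) (Φ : M[X][X]) (hΦ : Φ.Monic)
    (bz : ∃ (a b : M[X][X]) (c : M[X]), c ≠ 0 ∧ a * Φ + b * derivative Φ = C c)
    (α w : M[X]) (t : V) (hw : (w.map (algebraMap M V)).eval t ≠ 0)
    (h1 : (bs (algebraMap M V) (α.map (algebraMap M V) + w.map (algebraMap M V) * (C b0 + C b1 * X)) Φ).eval t = 0)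
    (h2 : (derivative (bs (algebraMap M V) (α.map (algebraMap M V) + w.map (algebraMap M V) * (C b0 + C b1 * X)) Φ)).eval t = 0) :
    False := by
  set f : V[X] := α.map (algebraMap M V) + w.map (algebraMap M V) * (C b0 + C b1 * X) with hf
  set x := f.eval t with hx
  set G := Φ.map (mapRingHom (algebraMap M V)) with hG
  have hGx : (G.eval (C x)).eval t = 0 := by
    rw [bs_def] at h1
    rw [← h1, ← eval_eval_map, hx]
    have := eval_map_apply (evalRingHom t) (p := G) f
    simpa using this
  have key : ∃ b : V[X], f = C x + (X - C t) * b := by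
    obtain ⟨b, hb⟩ := dvd_iff_isRoot.2 (show IsRoot (f - C x) t by simp [hx])
    exact ⟨b, by rw [← hb]; ring⟩
  obtain ⟨b, hfb⟩ := key
  obtain ⟨γ, hγ⟩ := Good.expand G hGx
  have hbt : b.eval t = (derivative f).eval t := by rw [hfb]; simp
  have hder : (derivative (G.eval (C x))).eval t + ((derivative G).eval (C x)).eval t * (derivative f).eval t = 0 := by
    obtain ⟨k, hk⟩ := bs_expand (RingHom.id V) G (C x) (X - C t) γ hγ b
    have e1 : bs (algebraMap M V) f Φ = bs (RingHom.id V) f G := by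
      rw [hG, bs_map']; rfl
    simp only [Polynomial.map_id] at hk
    rw [e1, hfb, hk] at h2
    rw [hγ, ← hbt]
    simpa using h2
  by_cases hc : ((derivative G).eval (C x)).eval t = 0
  · obtain ⟨a, b', c, hc0, hbz⟩ := bz
    have hct : (c.map (algebraMap M V)).eval t = 0 := by
      have := congrArg (fun p => ((p.map (mapRingHom (algebraMap M V))).eval (C x)).eval t) hbz
      simp only [Polynomial.map_add, Polynomial.map_mul, ← derivative_map, ← hG, eval_add, eval_mul, hc, hGx, map_C, eval_C] at this
      simpa using this.symm
    obtain ⟨s, rfl⟩ := (IsAlgClosed.splits c).mem_range_of_isRoot hc0 (i := algebraMap M V) (x := t) hct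
    have hm : (Φ.map (evalRingHom s)).Monic := hΦ.map _
    obtain ⟨y, hy⟩ := (IsAlgClosed.splits (Φ.map (evalRingHom s))).mem_range_of_isRoot hm.ne_zero (i := algebraMap M V) (x := x) (by
      rw [IsRoot, ← hGx, ← eval_eval_map, hG, Polynomial.map_map, Polynomial.map_map]
      congr 2
      ext <;> simp)
    have h3 : algebraMap M V y = algebraMap M V (α.eval s) + algebraMap M V (w.eval s) * (b0 + b1 * algebraMap M V s) := by
      rw [hy, hx, hf]; simp [aeval_algebraMap_apply]
    have hws : w.eval s ≠ 0 := by
      intro h; apply hw; simp [eval_map_apply, h]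
    have h4 := (algebraicIndependent_iff.1 hb) (MvPolynomial.X 0 + MvPolynomial.C s * MvPolynomial.X 1 - MvPolynomial.C ((y - α.eval s) / w.eval s)) (by
      have : algebraMap M V (w.eval s) ≠ 0 := by simpa using hws
      simp [Set.pair_comm]
      field_simp
      rw [h3]; ring)
    have h5 := congrArg (MvPolynomial.coeff (Finsupp.single 0 1)) h4
    simp [MvPolynomial.coeff_C_mul, MvPolynomial.coeff_X, MvPolynomial.coeff_C, Finsupp.single_left_inj] at h5
    rw [if_neg (fun h => by simpa using (DFunLike.congr_fun h 0))] at h5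
    simp at h5
  · set E := IntermediateField.adjoin M {t} with hE
    set N := algebraicClosure E V with hN
    have htE : t ∈ E := IntermediateField.mem_adjoin_simple_self M t
    let tE : E := ⟨t, htE⟩
    have hmx : (Φ.map ((evalRingHom tE).comp (mapRingHom (algebraMap M E)))).Monic := hΦ.map _
    have hxN : x ∈ N := by
      rw [hN, mem_algebraicClosure_iff]
      refine ⟨_, hmx.ne_zero, ?_⟩
      rw [← hGx, ← eval_eval_map, hG, Polynomial.map_map, aeval_def, eval₂_eq_eval_map, Polynomial.map_map]
      congr 2
      ext
      · simp
      · simp [tE]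
    let tN : N := algebraMap E N tE
    have htN : algebraMap N V tN = t := rfl
    let xN : N := ⟨x, hxN⟩
    have hxNx : algebraMap N V xN = x := rfl
    let j : M →+* N := (algebraMap E N).comp (algebraMap M E)
    have hj : (algebraMap N V).comp j = algebraMap M V := by
      ext m
      rfl
    have hj' : ∀ m, algebraMap N V (j m) = algebraMap M V m := fun m => rfl
    let GN := Φ.map (mapRingHom j)
    have hGN : GN.map (mapRingHom (algebraMap N V)) = G := by
      simp only [GN, hG, Polynomial.map_map]
      congr 1
      ext m
      · simp [hj']
      · simp
    have hder1 : (derivative (G.eval (C x))).eval t = algebraMap N V ((derivative (GN.eval (C xN))).eval tN) := by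
      rw [← eval_eval_hom', hGN]; rfl
    have hder2 : ((derivative G).eval (C x)).eval t = algebraMap N V (((derivative GN).eval (C xN)).eval tN) := by
      rw [← eval_eval_hom, ← derivative_map, hGN]; rfl
    have hev : ∀ p : M[X], (p.map (algebraMap M V)).eval t ∈ N := by
      intro p
      have : (p.map (algebraMap M V)).eval t = algebraMap N V ((p.map j).eval tN) := by
        rw [← eval_map_apply, Polynomial.map_map, hj]; rfl
      rw [this]; exact Subtype.mem _
    have hdf : (derivative f).eval t ∈ N := by
      have : (derivative f).eval t = - (derivative (G.eval (C x))).eval t / ((derivative G).eval (C x)).eval t := by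
        rw [eq_div_iff hc]; linear_combination hder
      rw [this]
      refine div_mem (neg_mem ?_) ?_
      · rw [hder1]; exact Subtype.mem _
      · rw [hder2]; exact Subtype.mem _
    have htN' : t ∈ N := Subtype.mem tN
    have hu : b0 + b1 * t ∈ N := by
      have : b0 + b1 * t = (x - (α.map (algebraMap M V)).eval t) / (w.map (algebraMap M V)).eval t := by
        rw [eq_div_iff hw, hx, hf]; simp; ring
      rw [this]
      exact div_mem (sub_mem hxN (hev _)) (hev _)
    have hb1 : b1 ∈ N := by
      have : b1 = ((derivative f).eval t - ((derivative α).map (algebraMap M V)).eval t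
          - ((derivative w).map (algebraMap M V)).eval t * (b0 + b1 * t)) / (w.map (algebraMap M V)).eval t := by
        rw [eq_div_iff hw, hf]; simp; ring
      rw [this]
      exact div_mem (sub_mem (sub_mem hdf (hev _)) (mul_mem (hev _) hu)) (hev _)
    have hb0 : b0 ∈ N := by
      have : b0 = (b0 + b1 * t) - b1 * t := by ring
      rw [this]
      exact sub_mem hu (mul_mem hb1 htN')
    rw [hN, mem_algebraicClosure_iff] at hb0 hb1
    exact algdep_two b0 b1 t hb (IntermediateField.isAlgebraic_adjoin_iff.1 hb0)
      (IntermediateField.isAlgebraic_adjoin_iff.1 hb1)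

section GeoS
variable {M : Type} [Field M] [IsAlgClosed M] {n : ℕ} {Φ g g' : M[X][X]}

lemma eval_eval_gen {A : Type} [CommRing A] (G : A[X][X]) (l : A[X]) (t : A) :
    (G.eval l).eval t = (G.eval (C (l.eval t))).eval t := by
  rw [← eval_eval_map]
  have := eval_map_apply (evalRingHom t) (p := G) l
  simpa using this.symm

lemma Good.osc (h : Good n Φ g g') : ∃ (t0 : M) (l κ : M[X]), l.natDegree ≤ 1 ∧
    Φ.eval l = (X - C t0) ^ 2 * κ ∧ ((derivative Φ).eval l).eval t0 ≠ 0 ∧ (g'.eval l).eval t0 ≠ 0 := by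
  obtain ⟨t0, x0, h0, h1, h2, h3⟩ := h.point
  have hΦ0 : (Φ.eval (C x0)).eval t0 = 0 := by rw [h.fac]; simp [h0]
  obtain ⟨γ, hγ⟩ := Good.expand Φ hΦ0
  set d := ((derivative Φ).eval (C x0)).eval t0 with hd
  obtain ⟨k, hk⟩ := bs_expand (RingHom.id M) Φ (C x0) (X - C t0) γ hγ (C (- γ.eval t0 / d))
  simp only [Polynomial.map_id] at hk
  obtain ⟨κ, hκ⟩ := dvd_iff_isRoot.2 (show IsRoot (γ + (derivative Φ).eval (C x0) * (C (- γ.eval t0 / d)) + (X - C t0) * k) t0 by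
    simp [IsRoot, ← hd]; field_simp; ring)
  have hl : (C x0 + (X - C t0) * C (- γ.eval t0 / d)).eval t0 = x0 := by simp
  refine ⟨t0, C x0 + (X - C t0) * C (- γ.eval t0 / d), κ, ?_, ?_, ?_, ?_⟩
  · compute_degree
  · rw [bs_def] at hk
    have e : Φ.map (mapRingHom (RingHom.id M)) = Φ := by
      convert Polynomial.map_id
      ext <;> simp
    rw [e] at hk
    rw [hk, hκ]; ring
  · rw [eval_eval_gen, hl]; exact h3
  · rw [eval_eval_gen, hl]; exact h2

lemma Good.geoS_aux (h : Good n Φ g g') (hn : 3 ≤ n) {M1 W : Type} [Field M1] [Field W]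
    [IsAlgClosed W] (ι : M →+* M1) (b0 b1 : M1)
    (hb : ∀ p : MvPolynomial (Fin 2) M, p.eval₂ ι ![b0, b1] = 0 → p = 0)
    (θ : MvPolynomial (Fin (n + 1)) M1 →+* W) (hθ : Function.Injective θ) :
    ∃ (K1 : Type) (_ : Field K1)
    (φ : MvPolynomial (Fin (n + 1)) M →+* K1), Function.Injective φ ∧
      ∃ (u : K1) (g2 : K1[X]) (s : Multiset K1),
      (substF n Φ).map φ = C u * g2 * (s.map fun ρ => X - C ρ).prod ∧ Irreducible g2 ∧
      g2.natDegree = 2 ∧ g2 ∣ (substF n g).map φ := by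
  obtain ⟨t0, l, κ, hl, hlκ, hx, hg'⟩ := h.osc
  obtain ⟨β, hβ⟩ := hpoly_exists h
  set b : M1[X] := C b0 + C b1 * X + C (ι β) * X ^ (n - 2) with hbdef
  obtain ⟨k, hk⟩ := bs_expand ι Φ l ((X - C t0) ^ 2) κ hlκ b
  set f0 : M1[X] := l.map ι + ((X - C t0) ^ 2).map ι * b with hf0
  set q : M1[X] := κ.map ι + ((derivative Φ).eval l).map ι * b + ((X - C t0) ^ 2).map ι * k with hq
  have hbd : b.natDegree ≤ n - 2 := by
    rw [hbdef]
    have : 1 ≤ n - 2 := by omega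
    refine (natDegree_add_le _ _).trans (max_le ((natDegree_add_le _ _).trans (max_le (by simp) ?_)) ?_)
    · refine le_trans ?_ this; compute_degree
    · compute_degree
  have hwd : (((X - C t0) ^ 2).map ι).natDegree ≤ 2 := by
    refine natDegree_map_le.trans ?_
    compute_degree
  have hfd : f0.natDegree ≤ n := by
    refine (natDegree_add_le _ _).trans (max_le (natDegree_map_le.trans (by omega)) (natDegree_mul_le.trans ?_))
    omega
  have hfc : f0.coeff n = b.coeff (n - 2) := by
    rw [hf0, coeff_add, coeff_eq_zero_of_natDegree_lt (lt_of_le_of_lt (natDegree_map_le.trans hl) (by omega)), zero_add]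
    conv_lhs => rw [show n = 2 + (n - 2) by omega]
    rw [coeff_mul_top hwd (by omega)]
    have : (((X - C t0) ^ 2).map ι).coeff 2 = 1 := by
      have := (((monic_X_sub_C t0).pow 2).map ι).coeff_natDegree
      rwa [((monic_X_sub_C t0).pow 2).natDegree_map, (monic_X_sub_C t0).natDegree_pow, natDegree_X_sub_C, mul_one] at this
    rw [this, one_mul]
  have hb1 : ∀ m : M, b1 ≠ ι m := by
    intro m hm
    have := hb (MvPolynomial.X 1 - MvPolynomial.C m) (by simp [hm])
    have h5 := congrArg (MvPolynomial.coeff (Finsupp.single 1 1)) this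
    simp [MvPolynomial.coeff_C] at h5
    rw [if_neg (fun h => by simpa using (DFunLike.congr_fun h 1))] at h5
    simp at h5
  have h0 : (hpoly n Φ).eval₂ ι (f0.coeff n) ≠ 0 := by
    rw [hfc]
    by_cases hn3 : n = 3
    · subst hn3
      have : b.coeff (3 - 2) = b1 + ι β := by
        simp [hbdef, coeff_C]
      rw [this]
      intro hh
      obtain ⟨m, hm⟩ := (IsAlgClosed.splits (hpoly 3 Φ)).mem_range_of_isRoot (hpoly_ne_zero 3 Φ h.monΦ) (i := ι) (x := b1 + ι β) (by rw [IsRoot, eval_map]; exact hh)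
      apply hb1 (m - β)
      rw [map_sub, hm]; ring
    · have : b.coeff (n - 2) = ι β := by
        simp [hbdef, coeff_C, coeff_X, show n - 2 ≠ 0 by omega, show 1 ≠ n - 2 by omega]
      rw [this, eval₂_at_apply]
      intro hh
      exact hβ (ι.injective (by rw [hh, map_zero]))
  have hqt : q.eval (ι t0) ≠ 0 := by
    intro hh
    have hp := hb (MvPolynomial.C (κ.eval t0) + MvPolynomial.C (((derivative Φ).eval l).eval t0) *
      (MvPolynomial.X 0 + MvPolynomial.C t0 * MvPolynomial.X 1 + MvPolynomial.C (β * t0 ^ (n - 2)))) (by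
        rw [← hh, hq, hbdef]
        simp [eval_map, eval₂_at_apply]
        left
        ring)
    have h5 := congrArg (MvPolynomial.coeff (Finsupp.single 0 1)) hp
    have hz : (0 : Fin 2 →₀ ℕ) ≠ Finsupp.single 0 1 := fun h => by simpa using (DFunLike.congr_fun h 0)
    simp only [MvPolynomial.coeff_add, MvPolynomial.coeff_C_mul, MvPolynomial.coeff_C, if_neg hz, MvPolynomial.coeff_X, Finsupp.single_left_inj one_ne_zero] at h5
    simp at h5
    exact hx h5
  obtain hdeg := emb_deg h.slp ι θ f0 h0
  set κ' : M →+* W := θ.comp (MvPolynomial.C.comp ι) with hκ'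
  have e1 : ((substF n Φ).map (emb ι θ f0)).map (PowerSeries.constantCoeff (R := W)) =
      (X - C (κ' t0)) ^ 2 * q.map (θ.comp MvPolynomial.C) := by
    rw [emb_const _ _ _ hfd, hk]
    simp [hκ']
  have hqt' : (q.map (θ.comp MvPolynomial.C)).eval (κ' t0) ≠ 0 := by
    have : κ' t0 = (θ.comp MvPolynomial.C) (ι t0) := rfl
    rw [this, eval_map_apply]
    intro hh
    exact hqt ((θ.comp MvPolynomial.C).injective (by rw [hh, map_zero]))
  have hsep : (q.map (θ.comp MvPolynomial.C)).Separable := by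
    rw [Separable, isCoprime_iff_aeval_ne_zero_of_isAlgClosed (k := W) (K := W)]
    intro a
    by_contra! hcon
    obtain ⟨ha1, ha2⟩ := hcon
    rw [coe_aeval_eq_eval] at ha1 ha2
    have hat : a ≠ κ' t0 := by rintro rfl; exact hqt' ha1
    letI : Algebra M W := κ'.toAlgebra
    have hal : algebraMap M W = κ' := rfl
    have e2 : (l + (X - C t0) ^ 2 * (C β * X ^ (n - 2))).map (algebraMap M W) +
        ((X - C t0) ^ 2).map (algebraMap M W) * (C (θ (MvPolynomial.C b0)) + C (θ (MvPolynomial.C b1)) * X) =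
        f0.map (θ.comp MvPolynomial.C) := by
      rw [hal, hf0, hbdef]
      simp only [Polynomial.map_add, Polynomial.map_mul, Polynomial.map_map, map_C, Polynomial.map_pow, map_X]
      rw [hκ', RingHom.comp_assoc]
      simp only [RingHom.comp_apply]
      ring
    have e3 : bs (algebraMap M W) (f0.map (θ.comp MvPolynomial.C)) Φ = (X - C (κ' t0)) ^ 2 * q.map (θ.comp MvPolynomial.C) := by
      rw [← e1, emb_const _ _ _ hfd, bs_map]; rfl
    refine lemN (M := M) (V := W) (θ (MvPolynomial.C b0)) (θ (MvPolynomial.C b1)) ?_ Φ h.monΦ h.bz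
      (l + (X - C t0) ^ 2 * (C β * X ^ (n - 2))) ((X - C t0) ^ 2) a ?_ ?_ ?_
    · rw [algebraicIndependent_iff]
      intro p hp
      apply hb
      apply (θ.comp MvPolynomial.C).injective
      rw [map_zero, ← hp, MvPolynomial.hom_eval₂, MvPolynomial.aeval_def]
      congr 1
      ext i
      fin_cases i <;> simp
    · rw [hal]; simpa [sub_eq_zero] using hat
    · rw [e2, e3]; simp [ha1]
    · rw [e2, e3, derivative_mul, eval_add, eval_mul, eval_mul, ha1, ha2]; simp
  have hcoeff : PowerSeries.coeff 1 (((substF n Φ).map (emb ι θ f0)).eval (PowerSeries.C (κ' t0))) ≠ 0 := by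
    have hC : (emb ι θ f0).comp MvPolynomial.C = (PowerSeries.C (R := W)).comp κ' := by
      ext r; simp [emb, hκ']
    have hF : (vpoly fun i => (emb ι θ f0) (MvPolynomial.X i)).eval (PowerSeries.C (κ' t0)) =
        PowerSeries.C (κ' (l.eval t0)) + PowerSeries.X * PowerSeries.C (∑ i : Fin (n + 1), θ (MvPolynomial.X i) * κ' t0 ^ (i : ℕ)) := by
      have e4 : κ' (l.eval t0) = ∑ i : Fin (n + 1), θ (MvPolynomial.C (f0.coeff i)) * κ' t0 ^ (i : ℕ) := by
        have e5 : f0.eval (ι t0) = ι (l.eval t0) := by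
          rw [hf0]; simp [eval_map, eval₂_at_apply]
        rw [hκ', RingHom.comp_apply, RingHom.comp_apply, ← e5]
        conv_lhs => rw [← vpoly_of_coeff f0 hfd]
        simp [vpoly, eval_finsetSum]
      rw [e4]
      simp only [vpoly, eval_finsetSum, eval_mul, eval_C, eval_pow, eval_X, map_sum, map_mul, map_pow, Finset.mul_sum]
      rw [← Finset.sum_add_distrib]
      apply Finset.sum_congr rfl
      intro i _
      simp [emb]
      ring
    rw [substF_map, bs_eval, hF, hC]
    set S := ∑ i : Fin (n + 1), θ (MvPolynomial.X i) * κ' t0 ^ (i : ℕ) with hS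
    have hS0 : S ≠ 0 := by
      have e6 : S = θ (∑ i : Fin (n + 1), MvPolynomial.C (ι t0 ^ (i : ℕ)) * MvPolynomial.X i) := by
        rw [hS, map_sum]
        apply Finset.sum_congr rfl
        intro i _
        simp [hκ']; ring
      rw [e6]
      intro hh
      have h7 : (∑ i : Fin (n + 1), MvPolynomial.C (ι t0 ^ (i : ℕ)) * MvPolynomial.X i : MvPolynomial (Fin (n + 1)) M1) = 0 :=
        hθ (by rw [hh, map_zero])
      have h8 := congrArg (MvPolynomial.coeff (Finsupp.single 0 1)) h7
      simp only [MvPolynomial.coeff_sum, MvPolynomial.coeff_C_mul, MvPolynomial.coeff_X, Finsupp.single_left_inj one_ne_zero] at h8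
      simp at h8
    have e7 : eval₂RingHom ((PowerSeries.C (R := W)).comp κ') (PowerSeries.C (κ' t0)) =
        ((PowerSeries.C (R := W)).comp κ').comp (evalRingHom t0) := by
      ext <;> simp
    rw [e7, ← eval_map, ← Polynomial.map_map]
    obtain ⟨k2, hk2⟩ := ((Φ.map (evalRingHom t0)).map ((PowerSeries.C (R := W)).comp κ')).binomExpansion (PowerSeries.C (κ' (l.eval t0))) (PowerSeries.X * PowerSeries.C S)
    rw [hk2]
    have e8 : PowerSeries.C (κ' (l.eval t0)) = ((PowerSeries.C (R := W)).comp κ') (l.eval t0) := rfl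
    rw [e8, derivative_map, eval_map_apply, eval_map_apply, derivative_map, eval_eval_map, eval_eval_map,
      ← eval_eval_gen, ← eval_eval_gen]
    have e9 : k2 * (PowerSeries.X * PowerSeries.C S) ^ 2 = PowerSeries.X ^ 2 * (k2 * PowerSeries.C S ^ 2) := by ring
    have e10 : ((PowerSeries.C (R := W)).comp κ') (((derivative Φ).eval l).eval t0) * (PowerSeries.X * PowerSeries.C S) =
      PowerSeries.C (κ' (((derivative Φ).eval l).eval t0) * S) * PowerSeries.X := by
        simp; ring
    rw [e9, e10, map_add, map_add, PowerSeries.coeff_X_pow_mul', if_neg (by norm_num), add_zero, RingHom.comp_apply,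
      PowerSeries.coeff_C, if_neg one_ne_zero, zero_add, PowerSeries.coeff_C_mul, PowerSeries.coeff_one_X, mul_one]
    exact mul_ne_zero (by simpa using hx) hS0
  obtain ⟨g2, u, s, hP, hgm, hgd, hgr, hgi⟩ := ps_double (κ' t0) ((substF n Φ).map (emb ι θ f0))
    (q.map (θ.comp MvPolynomial.C)) hdeg e1 hsep hqt' hcoeff
  set al := algebraMap (PowerSeries W) (FractionRing (PowerSeries W)) with halg
  have halinj : Function.Injective al := IsFractionRing.injective _ _
  refine ⟨FractionRing (PowerSeries W), inferInstance, al.comp (emb ι θ f0),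
    halinj.comp (emb_injective ι θ hθ f0), al u, g2.map al,
    s.map al, ?_, hgi, ?_, ?_⟩
  · rw [← Polynomial.map_map, hP]
    simp [Polynomial.map_multiset_prod, Multiset.map_map]
  · rw [natDegree_map_eq_of_injective halinj, hgd]
  · have hdv : g2.map al ∣ (substF n g).map (al.comp (emb ι θ f0)) * (substF n g').map (al.comp (emb ι θ f0)) := by
      rw [← Polynomial.map_mul, ← substF_mul, ← h.fac, ← Polynomial.map_map, hP]
      refine ⟨C (al u) * ((s.map fun ρ => X - C ρ).prod).map al, ?_⟩
      simp only [Polynomial.map_mul, map_C]; ring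
    rcases hgi.prime.dvd_or_dvd hdv with h1 | h1
    · exact h1
    · exfalso
      rw [← Polynomial.map_map, Polynomial.map_dvd_map _ halinj hgm] at h1
      obtain ⟨r, hr⟩ := h1
      have h2 := congrArg (fun p => (p.map (PowerSeries.constantCoeff (R := W))).eval (κ' t0)) hr
      simp only [emb_const _ _ _ hfd, Polynomial.map_mul, hgr] at h2
      have h3 : κ' t0 = (θ.comp MvPolynomial.C) (ι t0) := rfl
      rw [h3, eval_map_apply] at h2
      simp only [eval_mul, eval_pow, eval_sub, eval_X, eval_C, sub_self, ne_eq, OfNat.ofNat_ne_zero, not_false_eq_true, zero_pow, zero_mul] at h2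
      have h4 : (bs ι f0 g').eval (ι t0) = 0 := (θ.comp MvPolynomial.C).injective (by rw [h2, map_zero])
      apply hg'
      apply ι.injective
      rw [map_zero, ← h4, bs_def, eval_eval_gen (g'.map (mapRingHom ι))]
      have h5 : f0.eval (ι t0) = ι (l.eval t0) := by
        rw [hf0]; simp [eval_map, eval₂_at_apply]
      rw [h5, eval_eval_hom, ← eval_eval_gen]

lemma Good.geoS (h : Good n Φ g g') (hn : 3 ≤ n) :
    ∃ (K1 : Type) (_ : Field K1)
    (φ : MvPolynomial (Fin (n + 1)) M →+* K1), Function.Injective φ ∧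
      ∃ (u : K1) (g2 : K1[X]) (s : Multiset K1),
      (substF n Φ).map φ = C u * g2 * (s.map fun ρ => X - C ρ).prod ∧ Irreducible g2 ∧
      g2.natDegree = 2 ∧ g2 ∣ (substF n g).map φ := by
  let M1 := FractionRing (MvPolynomial (Fin 2) M)
  let al := algebraMap (MvPolynomial (Fin 2) M) M1
  refine h.geoS_aux hn (M1 := M1) (W := AlgebraicClosure (FractionRing (MvPolynomial (Fin (n + 1)) M1)))
    (al.comp MvPolynomial.C) (al (MvPolynomial.X 0)) (al (MvPolynomial.X 1)) ?_
    ((algebraMap (FractionRing (MvPolynomial (Fin (n + 1)) M1)) (AlgebraicClosure (FractionRing (MvPolynomial (Fin (n + 1)) M1)))).comp (algebraMap (MvPolynomial (Fin (n + 1)) M1) (FractionRing (MvPolynomial (Fin (n + 1)) M1)))) ?_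
  · intro p hp
    apply IsFractionRing.injective (MvPolynomial (Fin 2) M) M1
    rw [map_zero, ← hp]
    conv_lhs => rw [← MvPolynomial.eval₂_eta p]
    rw [MvPolynomial.hom_eval₂]
    congr 1
    ext i
    fin_cases i <;> simp [al]
  · exact (algebraMap (FractionRing (MvPolynomial (Fin (n + 1)) M1)) (AlgebraicClosure (FractionRing (MvPolynomial (Fin (n + 1)) M1)))).injective.comp (IsFractionRing.injective _ _)
end GeoS

section BZ

lemma bz_sep {K : Type} [Field K] (P : K[X][X]) (hirr : Irreducible P) (hmon : P.Monic)
    (hp : ringChar K ≠ 0)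
    (hsep : ∀ G : K[X][X], P ≠ G.comp (X ^ ringChar K)) :
    (P.map (algebraMap K[X] (FractionRing K[X]))).Separable := by
  rw [separable_iff_derivative_ne_zero (hmon.irreducible_iff_irreducible_map_fraction_map.1 hirr)]
  rw [derivative_map, Ne, Polynomial.map_eq_zero_iff (IsFractionRing.injective _ _)]
  intro h
  have : CharP K[X] (ringChar K) := inferInstance
  have h2 := expand_contract (ringChar K) h hp
  rw [expand_eq_comp_X_pow] at h2
  exact hsep _ h2.symm

lemma bz_clear {A : Type} [CommRing A] [IsDomain A] (P : A[X])
    (h : (P.map (algebraMap A (FractionRing A))).Separable) :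
    ∃ (a b : A[X]) (c : A), c ≠ 0 ∧ a * P + b * derivative P = C c := by
  obtain ⟨a, b, hab⟩ := h
  obtain ⟨c1, h1⟩ := IsLocalization.integerNormalization_map_to_map (nonZeroDivisors A) a
  obtain ⟨c2, h2⟩ := IsLocalization.integerNormalization_map_to_map (nonZeroDivisors A) b
  refine ⟨C (c2 : A) * IsLocalization.integerNormalization (nonZeroDivisors A) a,
    C (c1 : A) * IsLocalization.integerNormalization (nonZeroDivisors A) b, c1 * c2,
    mul_ne_zero (nonZeroDivisors.ne_zero c1.2) (nonZeroDivisors.ne_zero c2.2), ?_⟩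
  apply map_injective (algebraMap A (FractionRing A)) (IsFractionRing.injective _ _)
  rw [Polynomial.map_add, Polynomial.map_mul, Polynomial.map_mul, Polynomial.map_mul,
    Polynomial.map_mul, h1, h2, map_C, map_C, map_C, ← derivative_map]
  rw [Algebra.smul_def, Algebra.smul_def]
  simp only [Polynomial.algebraMap_apply, map_mul]
  linear_combination (C (algebraMap A (FractionRing A) c1) * C (algebraMap A (FractionRing A) c2)) * hab

lemma bz_base {K : Type} [Field K] {m : ℕ} (F : Fin m → K[X][X]) (hirr : ∀ i, Irreducible (F i))
    (hmon : ∀ i, (F i).Monic)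
    (hp : ringChar K ≠ 0) (hna : ∀ i j, i ≠ j → ¬ Associated (F i) (F j))
    (hsep : ∀ i, ∀ G : K[X][X], F i ≠ G.comp (X ^ ringChar K)) :
    ∃ (a b : K[X][X]) (c : K[X]), c ≠ 0 ∧ a * (∏ i, F i) + b * derivative (∏ i, F i) = C c := by
  apply bz_clear
  rw [Polynomial.map_prod]
  apply separable_prod
  · intro i j hij
    have hi := (hmon i).irreducible_iff_irreducible_map_fraction_map (K := FractionRing K[X]).1 (hirr i)
    have hj := (hmon j).irreducible_iff_irreducible_map_fraction_map (K := FractionRing K[X]).1 (hirr j)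
    rw [Function.onFun, hi.coprime_iff_not_dvd]
    intro hd
    have ha := hi.associated_of_dvd hj hd
    have := eq_of_monic_of_associated ((hmon i).map _) ((hmon j).map _) ha
    have := map_injective _ (IsFractionRing.injective _ _) this
    exact hna i j hij (this ▸ Associated.refl _)
  · intro i
    exact bz_sep _ (hirr i) (hmon i) hp (hsep i)

lemma good_of {K M : Type} [Field K] [Field M] (ι : K →+* M) {m n : ℕ} (F : Fin m → K[X][X])
    (hirr : ∀ i, Irreducible (F i)) (hmon : ∀ i, (F i).Monic)
    (hp : ringChar K ≠ 0) (hna : ∀ i j, i ≠ j → ¬ Associated (F i) (F j))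
    (hsep : ∀ i, ∀ G : K[X][X], F i ≠ G.comp (X ^ ringChar K))
    (hslope : ∀ i, slopeX (F i) ≤ ((n : ℚ) : WithBot ℚ))
    (g g' : M[X][X]) (hg : g.Monic) (hgi : Irreducible g)
    (hfac : (∏ i, F i).map (mapRingHom ι) = g * g') :
    Good n ((∏ i, F i).map (mapRingHom ι)) g g' := by
  have hm : (∏ i, F i).Monic := monic_prod_of_monic _ _ (fun i _ => hmon i)
  refine ⟨hfac, hm.map _, hg, hgi, ?_, ?_⟩
  · refine Slp.map hm ι (Slp.prod _ _ ?_ ?_)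
    · intro i _; exact hmon i
    · intro i _; exact slopeX_slp n _ (hmon i) (hslope i)
  · obtain ⟨a, b, c, hc, h⟩ := bz_base F hirr hmon hp hna hsep
    refine ⟨a.map (mapRingHom ι), b.map (mapRingHom ι), c.map ι, by
      rwa [Ne, Polynomial.map_eq_zero_iff ι.injective], ?_⟩
    rw [derivative_map, ← Polynomial.map_mul, ← Polynomial.map_mul, ← Polynomial.map_add, h]
    simp
end BZ

section SEP
/-- any two injective images of a generic polynomial have the same separability -/
lemma sep_transfer {A K1 K2 : Type} [CommRing A] [IsDomain A] [Field K1] [Field K2] (φ : A →+* K1)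
    (hφ : Function.Injective φ) (ψ : A →+* K2) (hψ : Function.Injective ψ) (P : A[X])
    (h : (P.map φ).Separable) : (P.map ψ).Separable := by
  have e1 : P.map φ = (P.map (algebraMap A (FractionRing A))).map (IsFractionRing.lift hφ) := by
    rw [Polynomial.map_map]; congr 1; ext x; simp
  have e2 : P.map ψ = (P.map (algebraMap A (FractionRing A))).map (IsFractionRing.lift hψ) := by
    rw [Polynomial.map_map]; congr 1; ext x; simp
  rw [e1, separable_map] at h
  rw [e2]
  exact h.map

lemma Good.sep {M : Type} [Field M] [IsAlgClosed M] {n : ℕ} {Φ g g' : M[X][X]}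
    (h : Good n Φ g g') (hn : 1 ≤ n) {K : Type} [Field K]
    (ψ : MvPolynomial (Fin (n + 1)) M →+* K) (hψ : Function.Injective ψ) :
    ((substF n g).map ψ).Separable := by
  obtain ⟨K1, _, φ, hφ, hi⟩ := h.geoT hn
  refine sep_transfer φ hφ ψ hψ _ ?_
  rw [separable_iff_derivative_ne_zero hi, derivative_map, Ne, Polynomial.map_eq_zero_iff hφ]
  exact h.deriv hn
end SEP

section LemJ

lemma lem_norm {Ka L E : Type} [Field Ka] [Field L] [Field E] [Algebra Ka L] [Normal Ka L]
    (j j' : L →+* E) (h : ∀ x, j (algebraMap Ka L x) = j' (algebraMap Ka L x)) :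
    ∃ σ : L ≃ₐ[Ka] L, ∀ y, j (σ y) = j' y := by
  let _ : Algebra L E := j.toAlgebra
  let _ : Algebra Ka E := (j.comp (algebraMap Ka L)).toAlgebra
  have : IsScalarTower Ka L E := IsScalarTower.of_algebraMap_eq (fun _ => rfl)
  let f : L →ₐ[Ka] E := { j' with commutes' := fun x => (h x).symm }
  refine ⟨f.restrictNormal' L, fun y => ?_⟩
  exact f.restrictNormal_commutes L y

lemma exists_lift {R S E : Type} [CommRing R] [IsDomain R] [Field S] [Field E] [IsAlgClosed E]
    [Algebra R S] [Algebra.IsAlgebraic R S] (hi : Function.Injective (algebraMap R S))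
    (ψ : R →+* E) (hψ : Function.Injective ψ) : ∃ j : S →+* E, ∀ r, j (algebraMap R S r) = ψ r := by
  let _ : Algebra R E := ψ.toAlgebra
  have : FaithfulSMul R E := (faithfulSMul_iff_algebraMap_injective _ _).2 hψ
  have : FaithfulSMul R S := (faithfulSMul_iff_algebraMap_injective _ _).2 hi
  have : Module.IsTorsionFree R E := inferInstance
  have : Module.IsTorsionFree R S := inferInstance
  let j : S →ₐ[R] E := IsAlgClosed.lift
  exact ⟨j, fun r => j.commutes r⟩

lemma exists_j {k L M E : Type} [Field k] [Field L] [Field M] [Field E] [IsAlgClosed E]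
    [Algebra k L] {n : ℕ} (a : Fin n → L) (ha : IsTranscendenceBasis k a) (ι : L →+* M)
    (φ : MvPolynomial (Fin n) M →+* E) (hφ : Function.Injective φ) :
    ∃ j : L →+* E, (∀ i, j (a i) = φ (MvPolynomial.X i)) ∧
      ∀ z : L, IsAlgebraic k z → j z = φ (MvPolynomial.C (ι z)) := by
  have hb : IsTranscendenceBasis (algebraicClosure k L) a :=
    (Algebra.IsIntegral.isTranscendenceBasis_iff (R := k) (S := algebraicClosure k L)).1 ha
  have hal := hb.isAlgebraic
  let ψ : Algebra.adjoin (algebraicClosure k L) (Set.range a) →+* E :=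
    (φ.comp (MvPolynomial.map (ι.comp (algebraMap (algebraicClosure k L) L)))).comp
      (hb.1.aevalEquiv.symm : Algebra.adjoin (algebraicClosure k L) (Set.range a) →+*
        MvPolynomial (Fin n) (algebraicClosure k L))
  have hψ : Function.Injective ψ := by
    refine (hφ.comp (MvPolynomial.map_injective _ (RingHom.injective _))).comp ?_
    exact hb.1.aevalEquiv.symm.injective
  obtain ⟨j, hj⟩ := exists_lift (R := Algebra.adjoin (algebraicClosure k L) (Set.range a)) (S := L)
    Subtype.val_injective ψ hψ
  refine ⟨j, fun i => ?_, fun z hz => ?_⟩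
  · have h1 : a i = algebraMap (Algebra.adjoin (algebraicClosure k L) (Set.range a)) L
        (hb.1.aevalEquiv (MvPolynomial.X i)) := by
      rw [AlgebraicIndependent.algebraMap_aevalEquiv]; simp
    conv_lhs => rw [h1]
    rw [hj]
    simp [ψ]
  · have h1 : z = algebraMap (Algebra.adjoin (algebraicClosure k L) (Set.range a)) L
        (hb.1.aevalEquiv (MvPolynomial.C ⟨z, mem_algebraicClosure_iff.2 hz⟩)) := by
      rw [AlgebraicIndependent.algebraMap_aevalEquiv]; simp [IntermediateField.algebraMap_apply]
    conv_lhs => rw [h1]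
    rw [hj]
    simp [ψ, IntermediateField.algebraMap_apply]

lemma trbasis {k R Ka L : Type} [Field k] [CommRing R] [Field Ka] [Field L] {n : ℕ}
    [Algebra k L] [Algebra Ka L] [Algebra (MvPolynomial (Fin n) k) Ka]
    [IsFractionRing (MvPolynomial (Fin n) k) Ka] [Algebra.IsAlgebraic Ka L]
    (h : ∀ c, algebraMap k L c = algebraMap Ka L (algebraMap (MvPolynomial (Fin n) k) Ka (MvPolynomial.C c))) :
    IsTranscendenceBasis k (fun i : Fin n => algebraMap Ka L (algebraMap (MvPolynomial (Fin n) k) Ka (MvPolynomial.X i))) := by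
  set a : Fin n → L := (fun i : Fin n => algebraMap Ka L (algebraMap (MvPolynomial (Fin n) k) Ka (MvPolynomial.X i)))
  have e : ∀ p : MvPolynomial (Fin n) k, MvPolynomial.aeval a p = algebraMap Ka L (algebraMap (MvPolynomial (Fin n) k) Ka p) := by
    intro p
    have : ((MvPolynomial.aeval a : MvPolynomial (Fin n) k →ₐ[k] L) : MvPolynomial (Fin n) k →+* L) =
      (algebraMap Ka L).comp (algebraMap (MvPolynomial (Fin n) k) Ka) := by
      ext i
      · simp [h]
      · simp [a]
    exact congrArg (fun f => f p) this
  have hi : AlgebraicIndependent k a := by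
    intro p q hpq
    rw [e, e] at hpq
    exact IsFractionRing.injective _ _ ((algebraMap Ka L).injective hpq)
  rw [hi.isTranscendenceBasis_iff_isAlgebraic]
  let _ : Algebra (MvPolynomial (Fin n) k) L := ((algebraMap Ka L).comp (algebraMap (MvPolynomial (Fin n) k) Ka)).toAlgebra
  have : IsScalarTower (MvPolynomial (Fin n) k) Ka L := IsScalarTower.of_algebraMap_eq (fun _ => rfl)
  have hal : Algebra.IsAlgebraic (MvPolynomial (Fin n) k) L :=
    (IsFractionRing.comap_isAlgebraic_iff (K := Ka)).2 inferInstance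
  constructor
  intro y
  obtain ⟨p, hp, hy⟩ := hal.isAlgebraic y
  refine ⟨p.map (hi.aevalEquiv : MvPolynomial (Fin n) k →+* Algebra.adjoin k (Set.range a)), ?_, ?_⟩
  · rwa [Ne, Polynomial.map_eq_zero_iff hi.aevalEquiv.injective]
  · rw [aeval_def, eval₂_map, ← hy, aeval_def]
    congr 1
    refine RingHom.ext fun p => ?_
    exact (hi.algebraMap_aevalEquiv p).trans (e p)
end LemJ

section PermKey

lemma perm_key {Γ V α : Type} [Group Γ] [MulAction Γ V] (U : Set V) (hU : U.Finite) (O : α → Set V)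
    (hUO : U = ⋃ x, O x) (hO : ∀ (γ : Γ) x, ∀ y ∈ O x, γ • y ∈ O x)
    (hT : ∀ x, ∀ y ∈ O x, ∀ z ∈ O x, ∃ γ : Γ, γ • y = z)
    (hD : ∀ x, ∃ x0 ∈ O x, ∀ y ∈ O x, ∀ z ∈ O x, y ≠ x0 → z ≠ x0 → ∃ γ : Γ, γ • x0 = x0 ∧ γ • y = z)
    (hS : ∀ x, ∃ y ∈ O x, ∃ z ∈ O x, y ≠ z ∧ ∃ γ : Γ, γ • y = z ∧ γ • z = y ∧
      ∀ w ∈ U, w ≠ y → w ≠ z → γ • w = w)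
    (π : V → V) (hπ : Set.BijOn π U U) (hπO : ∀ x, ∀ y ∈ O x, π y ∈ O x) :
    ∃ γ : Γ, ∀ y ∈ U, γ • y = π y := by
  classical
  have hUin : ∀ x, ∀ y ∈ O x, y ∈ U := fun x y hy => hUO ▸ Set.mem_iUnion.2 ⟨x, hy⟩
  have hUact : ∀ (γ : Γ), ∀ y ∈ U, γ • y ∈ U := by
    intro γ y hy
    rw [hUO] at hy
    obtain ⟨x, hx⟩ := Set.mem_iUnion.1 hy
    exact hUin x _ (hO γ x y hx)
  let Sw : V → V → Prop := fun y z => ∃ γ : Γ, γ • y = z ∧ γ • z = y ∧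
      ∀ w ∈ U, w ≠ y → w ≠ z → γ • w = w
  have hconj : ∀ y z, Sw y z → ∀ τ : Γ, Sw (τ • y) (τ • z) := by
    rintro y z ⟨γ, h1, h2, h3⟩ τ
    refine ⟨τ * γ * τ⁻¹, ?_, ?_, ?_⟩
    · simp [mul_smul, h1]
    · simp [mul_smul, h2]
    · intro w hw hy hz
      rw [mul_smul, mul_smul, h3 _ (hUact _ _ hw), smul_inv_smul]
      · rintro rfl; simp at hy
      · rintro rfl; simp at hz
  have hall : ∀ x, ∀ y ∈ O x, ∀ z ∈ O x, y ≠ z → Sw y z := by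
    intro x y hy z hz hyz
    obtain ⟨x0, hx0, hd⟩ := hD x
    obtain ⟨y0, hy0, z0, hz0, hne, hsw⟩ := hS x
    obtain ⟨γ1, h1⟩ := hT x y0 hy0 x0 hx0
    have s1 : Sw x0 (γ1 • z0) := h1 ▸ hconj _ _ hsw γ1
    have hne1 : γ1 • z0 ≠ x0 := by
      rw [← h1]; intro h; exact hne (smul_left_cancel _ h).symm
    obtain ⟨γ2, h2⟩ := hT x x0 hx0 y hy
    have hzz : γ2⁻¹ • z ≠ x0 := by
      intro h
      rw [inv_smul_eq_iff] at h
      exact hyz (h2.symm.trans h.symm)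
    obtain ⟨γ3, h3, h4⟩ := hd _ (hO γ1 x _ hz0) _ (hO γ2⁻¹ x _ hz) hne1 hzz
    have s2 := hconj _ _ s1 γ3
    rw [h3, h4] at s2
    have s3 := hconj _ _ s2 γ2
    rwa [h2, smul_inv_smul] at s3
  let p : Equiv.Perm U := Equiv.ofBijective (fun u => ⟨π u, hπ.1 u.2⟩) (by
    constructor
    · intro u v huv
      exact Subtype.ext (hπ.2.1 u.2 v.2 (congrArg Subtype.val huv))
    · intro v
      obtain ⟨u, hu, h⟩ := hπ.2.2 v.2
      exact ⟨⟨u, hu⟩, Subtype.ext h⟩)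
  let S : Set (Equiv.Perm U) := {s | s.IsSwap ∧ ∃ γ : Γ, ∀ u : U, (s u : V) = γ • (u : V)}
  have hp : p ∈ Subgroup.closure S := by
    rw [mem_closure_isSwap (fun f hf => hf.1)]
    have := hU.to_subtype
    refine ⟨Set.toFinite _, fun u => ?_⟩
    by_cases hu : p u = u
    · rw [hu]; exact MulAction.mem_orbit_self _
    obtain ⟨x, hx⟩ := Set.mem_iUnion.1 (hUO ▸ u.2 : (u : V) ∈ ⋃ x, O x)
    have hx' : (p u : V) ∈ O x := hπO x _ hx
    obtain ⟨γ, h1, h2, h3⟩ := hall x _ hx _ hx' (fun h => hu (Subtype.ext h.symm))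
    have hm : Equiv.swap u (p u) ∈ S := by
      refine ⟨⟨u, p u, fun h => hu h.symm, rfl⟩, γ, fun w => ?_⟩
      by_cases hw : w = u
      · rw [hw, Equiv.swap_apply_left, h1]
      by_cases hw' : w = p u
      · rw [hw', Equiv.swap_apply_right, h2]
      rw [Equiv.swap_apply_of_ne_of_ne hw hw', h3 _ w.2 (fun h => hw (Subtype.ext h)) (fun h => hw' (Subtype.ext h))]
    exact ⟨⟨_, Subgroup.subset_closure hm⟩, Equiv.swap_apply_left _ _⟩
  have hcl : ∀ s ∈ Subgroup.closure S, ∃ γ : Γ, ∀ u : U, (s u : V) = γ • (u : V) := by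
    intro s hs
    induction hs using Subgroup.closure_induction with
    | mem s hs => exact hs.2
    | one => exact ⟨1, fun u => by simp⟩
    | mul s t _ _ h1 h2 =>
      obtain ⟨γ, h1⟩ := h1
      obtain ⟨δ, h2⟩ := h2
      exact ⟨γ * δ, fun u => by rw [Equiv.Perm.mul_apply, h1, h2, mul_smul]⟩
    | inv s _ h1 =>
      obtain ⟨γ, h1⟩ := h1
      refine ⟨γ⁻¹, fun u => ?_⟩
      rw [eq_inv_smul_iff, ← h1]
      exact congrArg Subtype.val (s.apply_symm_apply u)
  obtain ⟨γ, hγ⟩ := hcl p hp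
  exact ⟨γ, fun y hy => (hγ ⟨y, hy⟩).symm⟩
end PermKey

section Keys

lemma bs_congr {N A : Type} [CommRing N] [CommRing A] (ι ι' : N →+* A) (f : A[X]) (G : N[X][X])
    (h : ∀ l b, ι ((G.coeff l).coeff b) = ι' ((G.coeff l).coeff b)) : bs ι f G = bs ι' f G := by
  rw [bs_def, bs_def]
  congr 1
  ext l b
  simpa using h l b

lemma eval_eq_bs {N : Type} [CommRing N] (f : N[X]) (G : N[X][X]) :
    eval f G = bs (RingHom.id N) f G := by
  rw [bs_def, mapRingHom_id, Polynomial.map_id]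

lemma substF_dvd {N : Type} [CommRing N] (n : ℕ) {P Q : N[X][X]} (h : P ∣ Q) :
    substF n P ∣ substF n Q := by
  obtain ⟨R, rfl⟩ := h
  exact ⟨substF n R, substF_mul n P R⟩

lemma substF_prod {N α : Type} [CommRing N] (n : ℕ) (s : Finset α) (P : α → N[X][X]) :
    substF n (∏ x ∈ s, P x) = ∏ x ∈ s, substF n (P x) := by
  simp only [substF_eq, map_prod]

lemma conj_of_irr {K E : Type} [Field K] [Field E] [Algebra K E] [Normal K E] {P : K[X]}
    (hP : Irreducible P) {y z : E} (hy : eval y (P.map (algebraMap K E)) = 0)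
    (hz : eval z (P.map (algebraMap K E)) = 0) : ∃ τ : E ≃ₐ[K] E, τ y = z := by
  rw [eval_map_algebraMap] at hy hz
  have : IsConjRoot K z y := by
    rw [IsConjRoot, ← minpoly.eq_of_irreducible hP hy, ← minpoly.eq_of_irreducible hP hz]
  exact this.exists_algEquiv

/-- the automorphisms fixing all constants -/
def constFix (k Ka L : Type) [Field k] [Field Ka] [Field L] [Algebra k L] [Algebra Ka L] :
    Subgroup (L ≃ₐ[Ka] L) where
  carrier := {σ | ∀ z, IsAlgebraic k z → σ z = z}
  mul_mem' := by
    intro σ τ hσ hτ z hz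
    rw [AlgEquiv.mul_apply, hτ z hz, hσ z hz]
  one_mem' := by intro z _; rfl
  inv_mem' := by
    intro σ hσ z hz
    conv_lhs => rw [← hσ z hz]
    exact σ.symm_apply_apply z

structure Ctx (k Ka : Type) {L M : Type} [Field k] [Field Ka] [Field L] [Field M] [Algebra k L]
    [Algebra Ka L] {n : ℕ} (a : Fin (n + 1) → L) (ι : L →+* M) {α : Type} [Fintype α]
    (G : α → L[X][X]) : Prop where
  tb : IsTranscendenceBasis k a
  gen : ∀ (E : Type) [Field E] (j j' : L →+* E),
    (∀ c : k, j (algebraMap k L c) = j' (algebraMap k L c)) → (∀ i, j (a i) = j' (a i)) →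
    ∀ x : Ka, j (algebraMap Ka L x) = j' (algebraMap Ka L x)
  aKa : ∀ i, ∃ b : Ka, algebraMap Ka L b = a i
  coef : ∀ x l b, IsAlgebraic k (((G x).coeff l).coeff b)
  good : ∀ x, ∃ g', Good n (∏ x, (G x).map (mapRingHom ι)) ((G x).map (mapRingHom ι)) g'
  spl : ∀ x, (eval (vpoly a) (G x)).Splits

variable {k Ka L M : Type} [Field k] [Field Ka] [Field L] [Field M] [Algebra k L]
    [Algebra Ka L] {n : ℕ} {a : Fin (n + 1) → L} {ι : L →+* M} {α : Type} [Fintype α]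
    {G : α → L[X][X]}

lemma Ctx.jj [Normal Ka L] (c : Ctx k Ka a ι G) {K1 : Type} [Field K1]
    (φ : MvPolynomial (Fin (n + 1)) M →+* K1) (hφ : Function.Injective φ) :
    ∃ j : L →+* AlgebraicClosure K1,
      (∀ x, (eval (vpoly a) (G x)).map j =
        ((substF n ((G x).map (mapRingHom ι))).map φ).map (algebraMap K1 (AlgebraicClosure K1))) ∧
      ∀ τ : AlgebraicClosure K1 ≃ₐ[K1] AlgebraicClosure K1, ∃ σ : constFix k Ka L, ∀ y : L,
        j (σ • y) = τ (j y) := by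
  obtain ⟨j, h1, h2⟩ := exists_j a c.tb ι ((algebraMap K1 (AlgebraicClosure K1)).comp φ)
    ((algebraMap K1 (AlgebraicClosure K1)).injective.comp hφ)
  refine ⟨j, fun x => ?_, fun τ => ?_⟩
  · rw [Polynomial.map_map, substF_map, bs_map', eval_eq_bs, bs_map, vpoly_map]
    simp only [h1]
    apply bs_congr
    intro l b
    exact h2 _ (c.coef x l b)
  · obtain ⟨σ, hσ⟩ := lem_norm (Ka := Ka) j ((τ : AlgebraicClosure K1 →+* AlgebraicClosure K1).comp j) (by
      apply c.gen
      · intro y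
        rw [RingHom.comp_apply, h2 _ (isAlgebraic_algebraMap _)]
        exact (τ.commutes _).symm
      · intro i
        rw [RingHom.comp_apply, h1]
        exact (τ.commutes _).symm)
    refine ⟨⟨σ, fun z hz => ?_⟩, fun y => hσ y⟩
    apply j.injective
    rw [hσ, RingHom.comp_apply, h2 _ hz]
    exact τ.commutes _

/-- roots of the specialised factor -/
def rts (a : Fin (n + 1) → L) (G : L[X][X]) : Set L := {y | eval y (eval (vpoly a) G) = 0}

lemma rts_image (hK : ∀ i, ∃ b : Ka, algebraMap Ka L b = a i) (σ : L ≃ₐ[Ka] L) (P : L[X][X]) :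
    σ '' rts a P = rts a (P.map (mapRingHom (σ : L →+* L))) := by
  have e : (eval (vpoly a) P).map (σ : L →+* L) = eval (vpoly a) (P.map (mapRingHom (σ : L →+* L))) := by
    rw [← coe_mapRingHom, ← eval_map_apply, coe_mapRingHom, vpoly_map]
    congr 2
    ext i
    obtain ⟨b, hb⟩ := hK i
    rw [← hb]
    exact σ.commutes b
  have e2 : ∀ y, y ∈ rts a P ↔ σ y ∈ rts a (P.map (mapRingHom (σ : L →+* L))) := by
    intro y
    simp only [rts, Set.mem_setOf_eq]
    rw [← e]
    have : σ y = (σ : L →+* L) y := rfl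
    rw [this, eval_map_apply, map_eq_zero_iff _ (σ : L →+* L).injective]
  ext z
  constructor
  · rintro ⟨y, hy, rfl⟩; exact (e2 y).1 hy
  · intro hz
    refine ⟨σ.symm z, (e2 _).2 (by simpa using hz), by simp⟩

lemma Ctx.fixes (c : Ctx k Ka a ι G) (σ : constFix k Ka L) (x : α) (y : L)
    (hy : y ∈ rts a (G x)) : σ • y ∈ rts a (G x) := by
  have h := rts_image c.aKa σ.1 (G x)
  have e : (G x).map (mapRingHom ((σ.1 : L ≃ₐ[Ka] L) : L →+* L)) = G x := by
    ext l b
    simpa using σ.2 _ (c.coef x l b)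
  rw [e] at h
  rw [← h]
  exact ⟨y, hy, rfl⟩

lemma rts_root {E : Type} [Field E] (j : L →+* E) (P : L[X][X]) (y : L) :
    y ∈ rts a P ↔ eval (j y) ((eval (vpoly a) P).map j) = 0 := by
  rw [eval_map_apply, map_eq_zero_iff _ j.injective]; rfl

variable [IsAlgClosed M]

lemma Ctx.ne (c : Ctx k Ka a ι G) (hn : 3 ≤ n) {K1 : Type} [Field K1]
    (φ : MvPolynomial (Fin (n + 1)) M →+* K1) (hφ : Function.Injective φ) (x : α) :
    ((substF n ((G x).map (mapRingHom ι))).map φ).Separable := by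
  obtain ⟨g', hg⟩ := c.good x
  exact hg.sep (by omega) φ hφ

lemma Ctx.ne_zero [Normal Ka L] (c : Ctx k Ka a ι G) (hn : 3 ≤ n) (x : α) : eval (vpoly a) (G x) ≠ 0 := by
  obtain ⟨j, h1, -⟩ := c.jj (algebraMap (MvPolynomial (Fin (n + 1)) M) (FractionRing (MvPolynomial (Fin (n + 1)) M)))
    (IsFractionRing.injective _ _)
  intro h0
  have := h1 x
  rw [h0, Polynomial.map_zero] at this
  exact ((c.ne hn _ (IsFractionRing.injective _ (FractionRing (MvPolynomial (Fin (n + 1)) M))) x).map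
    (f := algebraMap _ (AlgebraicClosure (FractionRing (MvPolynomial (Fin (n + 1)) M))))).ne_zero this.symm

lemma Ctx.lift_root [Normal Ka L] (c : Ctx k Ka a ι G) (hn : 3 ≤ n) {E : Type} [Field E]
    (j : L →+* E) (x : α) (t : E) (ht : eval t ((eval (vpoly a) (G x)).map j) = 0) :
    ∃ y ∈ rts a (G x), j y = t := by
  obtain ⟨y, hy⟩ := (c.spl x).mem_range_of_isRoot (c.ne_zero hn x) (i := j) (x := t) ht
  refine ⟨y, ?_, hy⟩
  rw [rts_root j, hy, ht]

lemma Ctx.keyT [Normal Ka L] (c : Ctx k Ka a ι G) (hn : 3 ≤ n) (x : α) :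
    ∀ y ∈ rts a (G x), ∀ z ∈ rts a (G x), ∃ σ : constFix k Ka L, σ • y = z := by
  intro y hy z hz
  obtain ⟨g', hg⟩ := c.good x
  obtain ⟨K1, _, φ, hφ, hi⟩ := hg.geoT (by omega)
  obtain ⟨j, h1, h2⟩ := c.jj φ hφ
  rw [rts_root j, h1] at hy hz
  obtain ⟨τ, hτ⟩ := conj_of_irr hi hy hz
  obtain ⟨σ, hσ⟩ := h2 τ
  exact ⟨σ, j.injective (by rw [hσ, hτ])⟩

lemma Ctx.keyD [Normal Ka L] (c : Ctx k Ka a ι G) (hn : 3 ≤ n) (x : α) :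
    ∃ x0 ∈ rts a (G x), ∀ y ∈ rts a (G x), ∀ z ∈ rts a (G x), y ≠ x0 → z ≠ x0 →
      ∃ σ : constFix k Ka L, σ • x0 = x0 ∧ σ • y = z := by
  obtain ⟨g', hg⟩ := c.good x
  obtain ⟨K1, _, φ, hφ, t, R, hR, hi⟩ := hg.geoD hn
  obtain ⟨j, h1, h2⟩ := c.jj φ hφ
  have hne := (c.ne hn φ hφ x).ne_zero
  obtain ⟨x0, hx0, hj⟩ := c.lift_root hn j x (algebraMap K1 (AlgebraicClosure K1) t) (by
    rw [h1, hR, eval_map_apply]; simp)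
  have key : ∀ y ∈ rts a (G x), y ≠ x0 → eval (j y) (R.map (algebraMap K1 (AlgebraicClosure K1))) = 0 := by
    intro y hy hyx
    rw [rts_root j, h1, hR, Polynomial.map_mul, eval_mul] at hy
    rcases mul_eq_zero.1 hy with h | h
    · exfalso
      apply hyx
      apply j.injective
      rw [hj]
      simpa [sub_eq_zero] using h
    · exact h
  refine ⟨x0, hx0, fun y hy z hz hyx hzx => ?_⟩
  have ky := key y hy hyx
  have kz := key z hz hzx
  rcases hi with hi | hi
  · obtain ⟨τ, hτ⟩ := conj_of_irr hi ky kz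
    obtain ⟨σ, hσ⟩ := h2 τ
    refine ⟨σ, j.injective ?_, j.injective (by rw [hσ, hτ])⟩
    rw [hσ, hj, τ.commutes]
  · exfalso
    rw [eq_C_of_natDegree_eq_zero hi] at ky
    simp at ky
    apply hne
    rw [hR, eq_C_of_natDegree_eq_zero hi, ky]
    simp

set_option maxHeartbeats 1000000 in
lemma Ctx.keyS [Normal Ka L] (c : Ctx k Ka a ι G) (hn : 3 ≤ n) (x : α) :
    ∃ y ∈ rts a (G x), ∃ z ∈ rts a (G x), y ≠ z ∧ ∃ σ : constFix k Ka L, σ • y = z ∧ σ • z = y ∧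
      ∀ w ∈ ⋃ x, rts a (G x), w ≠ y → w ≠ z → σ • w = w := by
  obtain ⟨g', hg⟩ := c.good x
  obtain ⟨K1, _, φ, hφ, u, g2, s, hR, hi, hdeg, hdvd⟩ := hg.geoS hn
  obtain ⟨j, h1, h2⟩ := c.jj φ hφ
  have hsep : g2.Separable := (c.ne hn φ hφ x).of_dvd hdvd
  let E := AlgebraicClosure K1
  have hcard : (g2.map (algebraMap K1 E)).roots.card = 2 := by
    rw [← hdeg, ← natDegree_map (p := g2) (algebraMap K1 E)]
    exact (IsAlgClosed.splits _).natDegree_eq_card_roots.symm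
  obtain ⟨y', z', hyz⟩ := Multiset.card_eq_two.1 hcard
  have hnd : (g2.map (algebraMap K1 E)).roots.Nodup := nodup_roots hsep.map
  have hg0 : g2.map (algebraMap K1 E) ≠ 0 := (hsep.map (f := algebraMap K1 E)).ne_zero
  rw [hyz] at hnd
  have hne' : y' ≠ z' := by simpa using hnd
  have hmem : ∀ w, eval w (g2.map (algebraMap K1 E)) = 0 ↔ w = y' ∨ w = z' := by
    intro w
    have := mem_roots hg0 (a := w)
    rw [hyz] at this
    rw [IsRoot] at this
    rw [← this]; simp
  have hy0 := (hmem y').2 (Or.inl rfl)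
  have hz0 := (hmem z').2 (Or.inr rfl)
  have hroot : ∀ w, eval w (g2.map (algebraMap K1 E)) = 0 → ∃ y ∈ rts a (G x), j y = w := by
    intro w hw
    apply c.lift_root hn
    rw [h1]
    exact eval_eq_zero_of_dvd_of_eval_eq_zero (Polynomial.map_dvd _ hdvd) hw
  obtain ⟨y, hy, hyj⟩ := hroot y' hy0
  obtain ⟨z, hz, hzj⟩ := hroot z' hz0
  obtain ⟨τ, hτ⟩ := conj_of_irr hi hy0 hz0
  have hτ2 : τ z' = y' := by
    have : eval (τ z') (g2.map (algebraMap K1 E)) = 0 := by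
      rw [eval_map_algebraMap] at hz0 ⊢
      rw [aeval_algHom_apply, hz0, map_zero]
    rcases (hmem _).1 this with h | h
    · exact h
    · exact absurd (τ.injective (hτ.trans h.symm)) hne'
  obtain ⟨σ, hσ⟩ := h2 τ
  refine ⟨y, hy, z, hz, fun h => hne' (by rw [← hyj, ← hzj, h]), σ, j.injective (by rw [hσ, hyj, hτ, hzj]),
    j.injective (by rw [hσ, hzj, hτ2, hyj]), ?_⟩
  intro w hw hwy hwz
  obtain ⟨x', hx'⟩ := Set.mem_iUnion.1 hw
  apply j.injective
  rw [hσ]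
  have hPhi : eval (j w) (((substF n (∏ x, (G x).map (mapRingHom ι))).map φ).map (algebraMap K1 E)) = 0 := by
    rw [rts_root j, h1] at hx'
    refine eval_eq_zero_of_dvd_of_eval_eq_zero (Polynomial.map_dvd _ (Polynomial.map_dvd _ ?_)) hx'
    exact substF_dvd n (Finset.dvd_prod_of_mem (fun x => (G x).map (mapRingHom ι)) (Finset.mem_univ x'))
  have hu : u ≠ 0 := by
    rintro rfl
    have : (substF n (∏ x, (G x).map (mapRingHom ι))).map φ ≠ 0 := by
      rw [substF_prod, Polynomial.map_prod, Finset.prod_ne_zero_iff]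
      intro x _
      exact (c.ne hn φ hφ x).ne_zero
    apply this
    rw [hR]; simp
  rw [hR, Polynomial.map_mul, Polynomial.map_mul, eval_mul, eval_mul, map_C, eval_C] at hPhi
  rcases mul_eq_zero.1 hPhi with h | h
  · rcases mul_eq_zero.1 h with h | h
    · simp [hu] at h
    · rcases (hmem _).1 h with h | h
      · exact absurd (j.injective (h.trans hyj.symm)) hwy
      · exact absurd (j.injective (h.trans hzj.symm)) hwz
  · rw [Polynomial.map_multiset_prod, eval_multiset_prod, Multiset.prod_eq_zero_iff] at h
    simp only [Multiset.map_map, Multiset.mem_map, Function.comp] at h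
    obtain ⟨r, -, hr⟩ := h
    have : j w = algebraMap K1 E r := by simpa [sub_eq_zero] using hr
    rw [this, τ.commutes]

lemma Ctx.main [Normal Ka L] (c : Ctx k Ka a ι G) (hn : 3 ≤ n) (π : L → L)
    (hπ : Set.BijOn π (⋃ x, rts a (G x)) (⋃ x, rts a (G x)))
    (hπO : ∀ x, ∀ y ∈ rts a (G x), π y ∈ rts a (G x)) :
    ∃ σ : L ≃ₐ[Ka] L, ∀ y ∈ ⋃ x, rts a (G x), σ y = π y := by
  obtain ⟨γ, hγ⟩ := perm_key (Γ := constFix k Ka L) (⋃ x, rts a (G x)) (Set.finite_iUnion (fun x => by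
      refine (Multiset.finite_toSet (eval (vpoly a) (G x)).roots).subset ?_
      intro y hy
      exact (mem_roots (c.ne_zero hn x)).2 hy)) (fun x => rts a (G x)) rfl
    (fun γ x y hy => c.fixes γ x y hy) (c.keyT hn) (c.keyD hn) (c.keyS hn) π hπ hπO
  exact ⟨γ.1, hγ⟩

end Keys

section Frob

lemma exists_frob (k L : Type) [Field k] [Fintype k] [Field L] [Algebra k L] (e : ℕ) :
    ∃ fr : L →ₐ[k] L, ∀ z, fr z = z ^ Fintype.card k ^ e := by
  refine ⟨FiniteField.frobeniusAlgHom k L ^ e, fun z => ?_⟩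
  rw [AlgHom.coe_pow, FiniteField.coe_frobeniusAlgHom, pow_iterate]

lemma frobTwist_eq {L : Type} [Field L] (q e : ℕ) (fr : L →+* L) (h : ∀ z, fr z = z ^ q ^ e)
    (P : L[X][X]) : frobTwist q e P = P.map (mapRingHom fr) := by
  have h1 : ∀ c : L[X], (c.sum fun b z => monomial b (z ^ q ^ e)) = c.map fr := by
    intro c
    rw [Polynomial.map, eval₂_eq_sum]
    simp [← C_mul_X_pow_eq_monomial, h]
  rw [frobTwist, Polynomial.map, eval₂_eq_sum]
  simp only [h1]
  simp [← C_mul_X_pow_eq_monomial]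

variable {k Ka L M : Type} [Field k] [Fintype k] [Field Ka] [Field L] [Field M] [Algebra k L]
    [Algebra Ka L] {n : ℕ} {a : Fin (n + 1) → L} {ι : L →+* M} {α : Type} [Fintype α]
    {G : α → L[X][X]}

lemma Ctx.twist (c : Ctx k Ka a ι G) (e : ℕ) (σ : L ≃ₐ[Ka] L) (x : α)
    (h : ∀ l b, σ (((G x).coeff l).coeff b) = (((G x).coeff l).coeff b) ^ Fintype.card k ^ e) :
    σ '' rts a (G x) = rts a (frobTwist (Fintype.card k) e (G x)) := by
  obtain ⟨fr, hfr⟩ := exists_frob k L e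
  rw [rts_image c.aKa, frobTwist_eq _ _ (fr : L →+* L) hfr]
  congr 1
  ext l b
  simp only [coeff_map, coe_mapRingHom]
  exact (h l b).trans (hfr _).symm

lemma Ctx.frob [Normal Ka L] (c : Ctx k Ka a ι G) (e : ℕ) :
    ∃ ρ : L ≃ₐ[Ka] L, ∀ z, IsAlgebraic k z → ρ z = z ^ Fintype.card k ^ e := by
  obtain ⟨fr, hfr⟩ := exists_frob k L e
  let K1 := FractionRing (MvPolynomial (Fin (n + 1)) M)
  let φ : MvPolynomial (Fin (n + 1)) M →+* AlgebraicClosure K1 :=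
    (algebraMap K1 (AlgebraicClosure K1)).comp (algebraMap (MvPolynomial (Fin (n + 1)) M) K1)
  have hφ : Function.Injective φ := (algebraMap K1 (AlgebraicClosure K1)).injective.comp (IsFractionRing.injective _ _)
  obtain ⟨j, h1, h2⟩ := exists_j a c.tb ι φ hφ
  obtain ⟨j', h1', h2'⟩ := exists_j a c.tb (ι.comp (fr : L →+* L)) φ hφ
  obtain ⟨σ, hσ⟩ := lem_norm (Ka := Ka) j j' (by
    apply c.gen
    · intro y
      rw [h2 _ (isAlgebraic_algebraMap _), h2' _ (isAlgebraic_algebraMap _)]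
      simp
    · intro i
      rw [h1, h1'])
  refine ⟨σ, fun z hz => ?_⟩
  apply j.injective
  rw [hσ, h2' _ hz, h2 _ (hz.pow _)]
  simp [hfr]

lemma Ctx.part2 (c : Ctx k Ka a ι G) (hk : ∀ y : k, ∃ b : Ka, algebraMap Ka L b = algebraMap k L y)
    (σ : L ≃ₐ[Ka] L) : ∃ e : ℕ, ∀ x l b,
      σ (((G x).coeff l).coeff b) = (((G x).coeff l).coeff b) ^ Fintype.card k ^ e := by
  let S : Set L := ⋃ x, ⋃ l ∈ (G x).support, (((G x).coeff l).coeffs : Set L)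
  have hS : S.Finite := Set.finite_iUnion fun x =>
    Set.Finite.biUnion (Finset.finite_toSet _) fun l _ => Finset.finite_toSet _
  have hmem : ∀ x l b, ((G x).coeff l).coeff b ∈ IntermediateField.adjoin k S := by
    intro x l b
    by_cases h0 : ((G x).coeff l).coeff b = 0
    · rw [h0]; exact zero_mem _
    apply IntermediateField.subset_adjoin
    refine Set.mem_iUnion.2 ⟨x, Set.mem_iUnion₂.2 ⟨l, ?_, ?_⟩⟩
    · rw [mem_support_iff]; rintro h; simp [h] at h0
    · exact coeff_mem_coeffs h0
  have hintegral : ∀ z ∈ S, IsIntegral k z := by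
    intro z hz
    obtain ⟨x, hz⟩ := Set.mem_iUnion.1 hz
    obtain ⟨l, hl, hz⟩ := Set.mem_iUnion₂.1 hz
    obtain ⟨b, -, rfl⟩ := mem_coeffs_iff.1 hz
    exact (c.coef x l b).isIntegral
  have := hS.to_subtype
  have hfin : FiniteDimensional k (IntermediateField.adjoin k S) :=
    IntermediateField.finiteDimensional_adjoin hintegral
  have : Finite (IntermediateField.adjoin k S) := Module.finite_of_finite k
  let σk : L ≃ₐ[k] L := AlgEquiv.ofRingEquiv (f := (σ : L ≃+* L)) (by
    intro y
    obtain ⟨b, hb⟩ := hk y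
    rw [← hb]
    exact σ.commutes b)
  have : IsGalois k (IntermediateField.adjoin k S) := inferInstance
  obtain ⟨e, he⟩ := (FiniteField.bijective_frobeniusAlgEquivOfAlgebraic_pow k
    (IntermediateField.adjoin k S)).2 (σk.restrictNormal (IntermediateField.adjoin k S))
  refine ⟨e, fun x l b => ?_⟩
  have h1 := AlgEquiv.restrictNormal_apply (IntermediateField.adjoin k S) σk ⟨_, hmem x l b⟩
  rw [← he] at h1
  refine (Eq.trans h1.symm ?_ : σk _ = _)
  simp only [AlgEquiv.coe_pow, FiniteField.coe_frobeniusAlgEquivOfAlgebraic_iterate]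
  rfl

lemma Ctx.part3 [Normal Ka L] [IsAlgClosed M] (c : Ctx k Ka a ι G) (hn : 3 ≤ n) (π : L → L)
    (hπ : Set.BijOn π (⋃ x, rts a (G x)) (⋃ x, rts a (G x))) (e : ℕ)
    (he : ∀ x, π '' rts a (G x) = rts a (frobTwist (Fintype.card k) e (G x))) :
    ∃ σ : L ≃ₐ[Ka] L, ∀ y ∈ ⋃ x, rts a (G x), σ y = π y := by
  obtain ⟨ρ, hρ⟩ := c.frob e
  have h1 : ∀ x, ρ '' rts a (G x) = rts a (frobTwist (Fintype.card k) e (G x)) := fun x =>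
    c.twist e ρ x fun l b => hρ _ (c.coef x l b)
  have h2 : ρ '' (⋃ x, rts a (G x)) = ⋃ x, rts a (G x) := by
    conv_rhs => rw [← hπ.image_eq]
    rw [Set.image_iUnion, Set.image_iUnion]
    simp only [h1, he]
  have hO : ∀ x, ∀ y ∈ rts a (G x), ρ.symm (π y) ∈ rts a (G x) := by
    intro x y hy
    have : π y ∈ ρ '' rts a (G x) := by rw [h1, ← he]; exact ⟨y, hy, rfl⟩
    obtain ⟨w, hw, hw2⟩ := this
    rw [← hw2, ρ.symm_apply_apply]
    exact hw
  have hB : Set.BijOn (fun y => ρ.symm (π y)) (⋃ x, rts a (G x)) (⋃ x, rts a (G x)) := by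
    refine ⟨?_, ?_, ?_⟩
    · intro y hy
      obtain ⟨x, hx⟩ := Set.mem_iUnion.1 hy
      exact Set.mem_iUnion.2 ⟨x, hO x y hx⟩
    · intro y hy z hz hyz
      exact hπ.2.1 hy hz (ρ.symm.injective hyz)
    · intro u hu
      have : ρ u ∈ ⋃ x, rts a (G x) := h2 ▸ ⟨u, hu, rfl⟩
      obtain ⟨y, hy, hyu⟩ := hπ.2.2 this
      exact ⟨y, hy, by simp [hyu]⟩
  obtain ⟨σ, hσ⟩ := c.main hn (fun y => ρ.symm (π y)) hB hO
  refine ⟨ρ * σ, fun y hy => ?_⟩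
  rw [AlgEquiv.mul_apply, hσ y hy, ρ.apply_symm_apply]
end Frob

section Final

lemma substF_mapC {K M : Type} [CommRing K] [CommRing M] (n : ℕ) (ι : K →+* M) (P : K[X][X]) :
    substF n (P.map (mapRingHom ι)) = (substF n P).map (MvPolynomial.map ι) := by
  rw [substF_map, substF_eq, bs_map']
  congr 1
  congr 1
  · ext c; simp
  · simp

theorem gen_main
    (m : ℕ) (n : ℕ) (hn : 3 ≤ n)
    (Fq : Type) [Field Fq] [Fintype Fq]
    (F : Fin m → Fq[X][X])
    (hna : ∀ i j, i ≠ j → ¬ Associated (F i) (F j))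
    (hirr : ∀ i, Irreducible (F i))
    (hmonic : ∀ i, (F i).Monic)
    (hsep : ∀ i, ∀ G : Fq[X][X], F i ≠ G.comp (X ^ ringChar Fq))
    (hslope : ∀ i, slopeX (F i) ≤ ((n : ℚ) : WithBot ℚ))
    (Ka L : Type) [Field Ka] [Field L] [Algebra (MvPolynomial (Fin (n + 1)) Fq) Ka]
    [IsFractionRing (MvPolynomial (Fin (n + 1)) Fq) Ka] [Algebra Ka L] [Algebra Fq L]
    (hem : algebraMap Fq L = (algebraMap Ka L).comp
      ((algebraMap (MvPolynomial (Fin (n + 1)) Fq) Ka).comp MvPolynomial.C))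
    [IsSplittingField Ka L ((substF n (∏ i, F i)).map (algebraMap _ Ka))]
    (μi : Fin m → ℕ) (hμ : ∀ i, 0 < μi i)
    (Gfac : ∀ i : Fin m, Fin (μi i) → L[X][X])
    (hGm : ∀ i j, (Gfac i j).Monic)
    (hGc : ∀ i j a b, (((Gfac i j).coeff a).coeff b) ^ Fintype.card Fq ^ (μi i)
        = ((Gfac i j).coeff a).coeff b)
    (hGF : ∀ i, (F i).map (mapRingHom (algebraMap Fq L)) = ∏ j, Gfac i j)
    (hGi : ∀ i j, Irreducible ((Gfac i j).map (mapRingHom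
        (algebraMap L (AlgebraicClosure L)))))
    (a : Fin (n + 1) → L) (ha : a = fun i => algebraMap Ka L (algebraMap (MvPolynomial (Fin (n + 1)) Fq) Ka (MvPolynomial.X i)))
    (U : Set L) (hU : U = ⋃ i, ⋃ j, rts a (Gfac i j)) :
    (∀ σ σ' : L ≃ₐ[Ka] L, (∀ y ∈ U, σ y = σ' y) → σ = σ') ∧
    (∀ σ : L ≃ₐ[Ka] L, ∃ e : ℕ, ∀ i j, σ '' rts a (Gfac i j) =
      rts a (frobTwist (Fintype.card Fq) e (Gfac i j))) ∧
    (∀ π : L → L, Set.BijOn π U U →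
        (∃ e : ℕ, ∀ i j, π '' rts a (Gfac i j) =
          rts a (frobTwist (Fintype.card Fq) e (Gfac i j))) →
        ∃ σ : L ≃ₐ[Ka] L, ∀ y ∈ U, σ y = π y) := by
  classical
  set P : Ka[X] := (substF n (∏ i, F i)).map (algebraMap _ Ka) with hP
  have hnorm : Normal Ka L := Normal.of_isSplittingField P
  let G : (Σ i, Fin (μi i)) → L[X][X] := fun x => Gfac x.1 x.2
  let M := AlgebraicClosure L
  let ι : L →+* M := algebraMap L M
  have hUx : U = ⋃ x, rts a (G x) := by
    rw [hU, Set.iUnion_sigma]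
  have hprodL : (∏ i, F i).map (mapRingHom (algebraMap Fq L)) = ∏ x, G x := by
    rw [Polynomial.map_prod, Fintype.prod_sigma]
    exact Finset.prod_congr rfl fun i _ => hGF i
  have hprodM : (∏ i, F i).map (mapRingHom (ι.comp (algebraMap Fq L))) =
      ∏ x, (G x).map (mapRingHom ι) := by
    rw [← Polynomial.map_prod, ← hprodL, Polynomial.map_map, mapRingHom_comp]
  have hchar : ringChar Fq ≠ 0 := CharP.ringChar_ne_zero_of_finite Fq
  have hgood : ∀ x, ∃ g', Good n (∏ x, (G x).map (mapRingHom ι)) ((G x).map (mapRingHom ι)) g' := by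
    intro x
    obtain ⟨g', hg'⟩ := Finset.dvd_prod_of_mem (fun x => (G x).map (mapRingHom ι)) (Finset.mem_univ x)
    refine ⟨g', ?_⟩
    rw [← hprodM]
    exact good_of _ F hirr hmonic hchar hna hsep hslope _ _ ((hGm _ _).map _) (hGi _ _)
      (hprodM.trans hg')
  have hne : ∀ x, substF n ((G x).map (mapRingHom ι)) ≠ 0 := by
    intro x h0
    obtain ⟨g', hg⟩ := hgood x
    have := (hg.sep (by omega) (algebraMap (MvPolynomial (Fin (n + 1)) M)
      (FractionRing (MvPolynomial (Fin (n + 1)) M))) (IsFractionRing.injective _ _)).ne_zero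
    rw [h0] at this
    simp at this
  have hS0 : substF n (∏ i, F i) ≠ 0 := by
    intro h0
    have h1 := substF_mapC n (ι.comp (algebraMap Fq L)) (∏ i, F i)
    rw [h0, hprodM, substF_prod, Polynomial.map_zero, Finset.prod_eq_zero_iff] at h1
    obtain ⟨x, -, hx⟩ := h1
    exact hne x hx
  have hP0 : P ≠ 0 := (Polynomial.map_ne_zero_iff (IsFractionRing.injective _ _)).2 hS0
  have hPL0 : P.map (algebraMap Ka L) ≠ 0 :=
    (Polynomial.map_ne_zero_iff (algebraMap Ka L).injective).2 hP0
  have hPL : P.map (algebraMap Ka L) = ∏ x, eval (vpoly a) (G x) := by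
    rw [hP, Polynomial.map_map, substF_map, ← eval_prod, ← hprodL, eval_eq_bs, bs_map', hem, ha]
    rfl
  have c : Ctx Fq Ka a ι G := by
    refine ⟨?_, ?_, ?_, ?_, hgood, ?_⟩
    · rw [ha]
      have : FiniteDimensional Ka L := IsSplittingField.finiteDimensional L P
      exact trbasis (R := Fq) (fun c => by rw [hem]; rfl)
    · intro E _ j j' h1 h2 x
      have : j.comp (algebraMap Ka L) = j'.comp (algebraMap Ka L) := by
        apply IsFractionRing.ringHom_ext (A := MvPolynomial (Fin (n + 1)) Fq)
        intro p
        have : (j.comp (algebraMap Ka L)).comp (algebraMap (MvPolynomial (Fin (n + 1)) Fq) Ka) =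
            (j'.comp (algebraMap Ka L)).comp (algebraMap (MvPolynomial (Fin (n + 1)) Fq) Ka) := by
          apply MvPolynomial.ringHom_ext
          · intro r
            have := h1 r
            rw [hem] at this
            exact this
          · intro i
            have := h2 i
            rw [ha] at this
            exact this
        exact congrArg (fun h => h p) this
      exact congrArg (fun h => h x) this
    · intro i; rw [ha]; exact ⟨_, rfl⟩
    · intro x l b
      have h1 : 1 < Fintype.card Fq ^ μi x.1 := Nat.one_lt_pow (hμ _).ne' Fintype.one_lt_card
      refine ⟨X ^ (Fintype.card Fq ^ μi x.1) - X, FiniteField.X_pow_card_sub_X_ne_zero Fq h1, ?_⟩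
      simp only [map_sub, map_pow, aeval_X]
      exact sub_eq_zero.2 (hGc x.1 x.2 l b)
    · intro x
      refine (IsSplittingField.splits L P).of_dvd hPL0 ?_
      rw [hPL]
      exact Finset.dvd_prod_of_mem (fun x => eval (vpoly a) (G x)) (Finset.mem_univ x)
  refine ⟨?_, ?_, ?_⟩
  · intro σ σ' h
    have := AlgHom.ext_of_adjoin_eq_top (IsSplittingField.adjoin_rootSet L P)
      (φ₁ := (σ : L →ₐ[Ka] L)) (φ₂ := (σ' : L →ₐ[Ka] L)) (by
        intro y hy
        apply h
        have hy := (mem_rootSet.1 hy).2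
        rw [← eval_map_algebraMap, hPL, eval_prod, Finset.prod_eq_zero_iff] at hy
        obtain ⟨x, -, hx⟩ := hy
        rw [hUx]
        exact Set.mem_iUnion.2 ⟨x, hx⟩)
    ext y
    exact congrArg (fun h => h y) this
  · intro σ
    obtain ⟨e, he⟩ := c.part2 (fun y => ⟨_, by rw [hem]; rfl⟩) σ
    exact ⟨e, fun i j => c.twist e σ ⟨i, j⟩ (he ⟨i, j⟩)⟩
  · rintro π hπ ⟨e, he⟩
    rw [hUx] at hπ ⊢
    exact c.part3 hn π hπ e (fun x => he x.1 x.2)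

end Final

/-- the structure of the Galois group `G` of the splitting field `L` of
`∏ F_i(t,f♯)` over `F_q(a_0,…,a_n)`, for pairwise non-associate irreducible monic
(in `x`) `F_i ∈ F_q[t][x]` separable over `F_q(t)` with `n ≥ 3`, `n ≥ sl F_i`.
Given the decompositions `F_i = ∏_{j<μ_i} G_{ij}` into absolutely irreducible factors
with coefficients in the minimal fields `F_{q^{μ_i}}` (realized inside `L`), with
root sets `Ω_{ij} ⊆ L` of the `G_{ij}(t,f♯)` and twisted root sets `Ω_{ij}^σ` for
`σ = Frob_q^e ∈ H_μ = Gal(F_{q^μ}/F_q)`: the restriction `G → Perm(⋃ Ω_{ij})` is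
injective, every `σ ∈ G` induces a permutation `π` with `π(Ω_{ij}) = Ω_{ij}^{Frob^e}`
for some `e`, and conversely every permutation `π` of `⋃ Ω_{ij}` with
`π(Ω_{ij}) = Ω_{ij}^{Frob^e}` for some `e` (and all `i, j`) is induced by some
element of `G`. -/
theorem galois_group_structure_for_non_absolutely_irreducible
    (m : ℕ) (hm : 1 ≤ m) (n : ℕ) (hn : 3 ≤ n)
    (Fq : Type) [Field Fq] [Fintype Fq]
    (F : Fin m → Polynomial (Polynomial Fq))
    (hdegx : ∀ i, 0 < (F i).natDegree)
    (hnonassoc : ∀ i j, i ≠ j → ¬ Associated (F i) (F j))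
    (hirr : ∀ i, Irreducible (F i))
    (hmonic : ∀ i, (F i).Monic)
    (hsep : ∀ i, ∀ G : Polynomial (Polynomial Fq),
      F i ≠ G.comp (Polynomial.X ^ ringChar Fq))
    (hslope : ∀ i, slopeX (F i) ≤ ((n : ℚ) : WithBot ℚ)) :
    let q := Fintype.card Fq
    let R := MvPolynomial (Fin (n + 1)) Fq
    let Ka := FractionRing R
    let Pprod : Polynomial Ka := (substF n (∏ i, F i)).map (algebraMap R Ka)
    let L := Pprod.SplittingField
    let em : Fq →+* L := (algebraMap Ka L).comp ((algebraMap R Ka).comp MvPolynomial.C)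
    let fsharpL : Polynomial L := ∑ j : Fin (n + 1),
      Polynomial.C (algebraMap Ka L (algebraMap R Ka (MvPolynomial.X j))) *
        Polynomial.X ^ (j : ℕ)
    ∀ (μi : Fin m → ℕ), (∀ i, 0 < μi i) →
    ∀ Gfac : (∀ i : Fin m, Fin (μi i) → Polynomial (Polynomial L)),
      -- each `G_{ij}` is monic in `x` with coefficients in `F_{q^{μ_i}} ⊆ L`
      (∀ i j, (Gfac i j).Monic) →
      (∀ i j a b, (((Gfac i j).coeff a).coeff b) ^ q ^ (μi i)
        = ((Gfac i j).coeff a).coeff b) →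
      -- `F_i = ∏_j G_{ij}`
      (∀ i, (F i).map (Polynomial.mapRingHom em) = ∏ j, Gfac i j) →
      -- each `G_{ij}` is absolutely irreducible
      (∀ i j, Irreducible ((Gfac i j).map (Polynomial.mapRingHom
        (algebraMap L (AlgebraicClosure L))))) →
      -- `F_{q^{μ_i}}` is the minimal field containing all coefficients of the `G_{ij}`
      (∀ i e, (∀ j a b, (((Gfac i j).coeff a).coeff b) ^ q ^ e
        = ((Gfac i j).coeff a).coeff b) → μi i ∣ e) →
      -- the root sets `Ω_{ij}` and their Frobenius twists `Ω_{ij}^{Frob^e}`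
      let Ω : ∀ i : Fin m, Fin (μi i) → Set L := fun i j =>
        {y : L | Polynomial.eval y (Polynomial.eval fsharpL (Gfac i j)) = 0}
      let Ωσ : ℕ → ∀ i : Fin m, Fin (μi i) → Set L := fun e i j =>
        {y : L | Polynomial.eval y (Polynomial.eval fsharpL (frobTwist q e (Gfac i j))) = 0}
      let U : Set L := ⋃ i, ⋃ j, Ω i j
      -- `G` embeds into the permutations of `⋃ Ω_{ij}` …
      (∀ σ σ' : L ≃ₐ[Ka] L, (∀ y ∈ U, σ y = σ' y) → σ = σ') ∧
      -- … the image is contained in the set of permutations moving each `Ω_{ij}` to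
      -- some common twist `Ω_{ij}^{Frob^e}` …
      (∀ σ : L ≃ₐ[Ka] L, ∃ e : ℕ, ∀ i j, σ '' Ω i j = Ωσ e i j) ∧
      -- … and conversely each such permutation of `⋃ Ω_{ij}` is induced by `G`.
      (∀ π : L → L, Set.BijOn π U U →
        (∃ e : ℕ, ∀ i j, π '' Ω i j = Ωσ e i j) →
        ∃ σ : L ≃ₐ[Ka] L, ∀ y ∈ U, σ y = π y) := by
  intro q R Ka Pprod L em fsharpL μi hμ Gfac hGm hGc hGF hGi hmin Ω Ωσ U
  letI : Algebra Fq L := em.toAlgebra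
  exact gen_main m n hn Fq F hnonassoc hirr hmonic hsep hslope Ka L rfl μi hμ Gfac hGm hGc hGF hGi
    (fun i => algebraMap Ka L (algebraMap R Ka (MvPolynomial.X i))) rfl U rfl
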